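/- arXiv:2009.12550 — 12 statements merged into one kernel-verified Lean document; each statement's English description precedes it below -/
import Mathlib

section
/- The unsplittable flow arc-set polyhedron P = conv(X) is full-dimensional, i.e., its (affine) dimension equals |Q| + |T|; equivalently, P contains |Q| + |T| + 1 affinely independent points. -/
open scoped BigOperators

/-- The unsplittable flow arc-set `X`. -/
def ufX {Q T : Type*} [Fintype Q] [Fintype T] (a : Q → ℝ) (b : T → ℝ) (c : ℝ) :
    Set ((Q → ℝ) × (T → ℝ)) :=
  {p | (∀ q, p.1 q = 0 ∨ p.1 q = 1) ∧ (∀ t, ∃ n : ℕ, p.2 t = n) ∧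
    ∑ q, a q * p.1 q ≤ ∑ t, b t * p.2 t + c}

/-- The unsplittable flow arc-set polyhedron `P = conv(X)`. -/
noncomputable def ufP {Q T : Type*} [Fintype Q] [Fintype T]
    (a : Q → ℝ) (b : T → ℝ) (c : ℝ) : Set ((Q → ℝ) × (T → ℝ)) :=
  convexHull ℝ (ufX a b c)

/-- Translating a linearly independent family by a point and adding the point itself gives an
affinely independent family. -/
theorem LinearIndependent.affineIndependent_option {k V ι : Type*} [Ring k] [AddCommGroup V]
    [Module k V] {v : ι → V} (hv : LinearIndependent k v) (p : V) :
    AffineIndependent k (fun o : Option ι => o.elim p (fun i => p + v i)) := by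
  rw [affineIndependent_iff_linearIndependent_vsub k _ none]
  convert hv.comp (fun o : {o : Option ι // o ≠ none} => o.1.get (Option.isSome_iff_ne_none.2 o.2))
    (fun o o' h => Subtype.ext (Option.get_inj.1 h)) using 1
  ext ⟨_ | i, ho⟩
  · exact absurd rfl ho
  · simp

/-- A binary-integral point `(x, y)` with `N ≤ y t1` lies in `X`, provided that `N` copies of
facility `t1` suffice to carry all commodities. -/
theorem mem_ufX_of_le {Q T : Type*} [Fintype Q] [Fintype T] {a : Q → ℝ} {b : T → ℝ} {c : ℝ}
    {t1 : T} (ha : ∀ q, 0 < a q) (hb : ∀ t, 0 < b t) {N : ℕ} (hN : ∑ q, a q - c ≤ N * b t1)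
    {p : (Q → ℝ) × (T → ℝ)} (hx : ∀ q, p.1 q = 0 ∨ p.1 q = 1)
    (hy : ∀ t, ∃ n : ℕ, p.2 t = n) (ht : (N : ℝ) ≤ p.2 t1) : p ∈ ufX a b c := by
  refine ⟨hx, hy, ?_⟩
  have h1 : ∑ q, a q * p.1 q ≤ ∑ q, a q := Finset.sum_le_sum fun q _ => by
    rcases hx q with h | h <;> simp [h, (ha q).le]
  have h2 : b t1 * p.2 t1 ≤ ∑ t, b t * p.2 t :=
    Finset.single_le_sum (f := fun t => b t * p.2 t) (fun t _ => by
      obtain ⟨n, hn⟩ := hy t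
      rw [hn]
      exact mul_nonneg (hb t).le n.cast_nonneg) (Finset.mem_univ t1)
  nlinarith [mul_le_mul_of_nonneg_left ht (hb t1).le]

/-- `P` is full-dimensional: it contains `|Q| + |T| + 1`
affinely independent points. -/
theorem ufP_full_dimensional {Q T : Type*} [Fintype Q] [Fintype T]
    (a : Q → ℝ) (b : T → ℝ) (c : ℝ) (t1 : T)
    (ha : ∀ q, 0 < a q) (hb : ∀ t, 0 < b t) (hb1 : ∀ t, b t1 ≤ b t)
    (hc : 0 < ∑ q, a q - c) :
    ∃ pts : Fin (Fintype.card Q + Fintype.card T + 1) → (Q → ℝ) × (T → ℝ),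
      (∀ i, pts i ∈ ufP a b c) ∧ AffineIndependent ℝ pts := by
  classical
  obtain ⟨N, hN⟩ := exists_nat_ge ((∑ q, a q - c) / b t1)
  rw [div_le_iff₀ (hb t1)] at hN
  have hv := ((Pi.basisFun ℝ Q).prod (Pi.basisFun ℝ T)).linearIndependent
  have hp := hv.affineIndependent_option (0, Pi.single t1 (N : ℝ))
  have e : Fin (Fintype.card Q + Fintype.card T + 1) ≃ Option (Q ⊕ T) :=
    (Fintype.equivFinOfCardEq (by simp)).symm
  refine ⟨_, fun i => subset_convexHull ℝ _ ?_, hp.comp_embedding e.toEmbedding⟩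
  simp only [Function.comp_apply, Equiv.coe_toEmbedding]
  have hsingle (t : T) : ∃ n : ℕ, (Pi.single t1 (N : ℝ) : T → ℝ) t = n :=
    ⟨(Pi.single t1 N : T → ℕ) t, by by_cases h : t = t1 <;> simp [h]⟩
  rcases e i with _ | q | t
  · exact mem_ufX_of_le ha hb hN (by simp) hsingle (by simp)
  · refine mem_ufX_of_le ha hb hN (fun q' => ?_) (by simpa using hsingle) (by simp)
    by_cases h : q' = q <;> simp [h]
  · refine mem_ufX_of_le ha hb hN (by simp) (fun t' => ?_) ?_
    · obtain ⟨n, hn⟩ := hsingle t'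
      by_cases h : t' = t
      · exact ⟨n + 1, by subst h; simp [hn]⟩
      · exact ⟨n, by simp [hn, h]⟩
    · by_cases h : t1 = t <;> simp [h]
end

section
/- For every x ∈ {0,1}^Q and every t ∈ T, the point (x, ρ_t(x)·f^t) is an extreme point (vertex) of P, where ρ_t(x) = max{⌈(Σ_{q∈Q} a_q x_q − c)/b_t⌉, 0}. -/
open scoped BigOperators

/-- A point of a set that is the unique minimizer of a linear functional over that set is an
extreme point of the convex hull of the set. -/
theorem mem_extremePoints_convexHull_of_forall_lt {E : Type*} [AddCommGroup E] [Module ℝ E]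
    {s : Set E} {p : E} (hp : p ∈ s) (f : E →ₗ[ℝ] ℝ) (h : ∀ z ∈ s, z ≠ p → f p < f z) :
    p ∈ Set.extremePoints ℝ (convexHull ℝ s) := by
  have hconv : Convex ℝ {z | z = p ∨ f p < f z} := by
    rintro u (rfl | hu) v (rfl | hv) α β hα hβ hαβ
    · exact Or.inl (by rw [← add_smul, hαβ, one_smul])
    · rcases hβ.eq_or_lt with rfl | hβ
      · exact Or.inl (by simp_all)
      · right
        simp only [map_add, map_smul, smul_eq_mul]
        obtain rfl : α = 1 - β := by linarith
        nlinarith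
    · rcases hα.eq_or_lt with rfl | hα
      · exact Or.inl (by simp_all)
      · right
        simp only [map_add, map_smul, smul_eq_mul]
        obtain rfl : β = 1 - α := by linarith
        nlinarith
    · exact Or.inr (convex_halfSpace_gt f.isLinear (f p) hu hv hα hβ hαβ)
  have hsub : convexHull ℝ s ⊆ {z | z = p ∨ f p < f z} :=
    convexHull_min (fun z hz => (eq_or_ne z p).imp id (h z hz)) hconv
  rw [(convex_convexHull ℝ s).mem_extremePoints_iff_convex_sdiff]
  refine ⟨subset_convexHull ℝ s hp, ?_⟩
  have hdiff : convexHull ℝ s \ {p} = convexHull ℝ s ∩ {z | f p < f z} := by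
    ext z
    constructor
    · rintro ⟨hz, hne⟩
      exact ⟨hz, (hsub hz).resolve_left hne⟩
    · rintro ⟨hz, hlt⟩
      refine ⟨hz, ?_⟩
      rintro rfl
      exact lt_irrefl (f z) hlt
  rw [hdiff]
  exact (convex_convexHull ℝ s).inter (convex_halfSpace_gt f.isLinear (f p))

/-- for every `x ∈ {0,1}^Q` and `t ∈ T`, the point
`(x, ρ_t(x) · fᵗ)` with `ρ_t(x) = max{⌈(Σ_q a_q x_q − c)/b_t⌉, 0}` is an
extreme point (vertex) of `P`. -/
theorem ufP_vertex {Q T : Type*} [Fintype Q] [Fintype T] [DecidableEq T]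
    (a : Q → ℝ) (b : T → ℝ) (c : ℝ) (t1 : T)
    (ha : ∀ q, 0 < a q) (hb : ∀ t, 0 < b t) (hb1 : ∀ t, b t1 ≤ b t)
    (hc : 0 < ∑ q, a q - c)
    (x : Q → ℝ) (hx : ∀ q, x q = 0 ∨ x q = 1) (t : T) :
    ((x, Pi.single t (max ((⌈(∑ q, a q * x q - c) / b t⌉ : ℤ) : ℝ) 0)) :
        (Q → ℝ) × (T → ℝ)) ∈ Set.extremePoints ℝ (ufP a b c) := by
  set r : ℝ := max ((⌈(∑ q, a q * x q - c) / b t⌉ : ℤ) : ℝ) 0 with hr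
  have hr0 : 0 ≤ r := le_max_right _ _
  have hrb : ∑ q, a q * x q - c ≤ b t * r := by
    rw [mul_comm, ← div_le_iff₀ (hb t)]
    exact (Int.le_ceil _).trans (le_max_left _ _)
  have hrmin : ∀ n : ℕ, ∑ q, a q * x q - c ≤ b t * n → r ≤ n := by
    intro n hn
    refine max_le ?_ n.cast_nonneg
    have : ⌈(∑ q, a q * x q - c) / b t⌉ ≤ (n : ℤ) := by
      rw [Int.ceil_le, div_le_iff₀ (hb t), mul_comm]
      exact_mod_cast hn
    exact_mod_cast this
  have hrnat : ∃ n : ℕ, r = n := by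
    refine ⟨⌈(∑ q, a q * x q - c) / b t⌉.toNat, ?_⟩
    rw [hr, ← Int.cast_natCast, Int.toNat_eq_max]
    push_cast
    rfl
  let k : T → ℝ := fun s => if s = t then 1 else r + 1
  let f : ((Q → ℝ) × (T → ℝ)) →ₗ[ℝ] ℝ :=
    (∑ q, ((r + 1) * (1 - 2 * x q)) • (LinearMap.proj q ∘ₗ LinearMap.fst ℝ (Q → ℝ) (T → ℝ))) +
      ∑ s, k s • (LinearMap.proj s ∘ₗ LinearMap.snd ℝ (Q → ℝ) (T → ℝ))
  have hf : ∀ z, f z = ∑ q, (r + 1) * (1 - 2 * x q) * z.1 q + ∑ s, k s * z.2 s := by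
    intro z
    simp [f, LinearMap.sum_apply]
  refine mem_extremePoints_convexHull_of_forall_lt ⟨hx, fun s => ?_, ?_⟩ f ?_
  · by_cases hs : s = t
    · subst hs
      simpa using hrnat
    · exact ⟨0, by simp [hs]⟩
  · simp only [Pi.single_apply, mul_ite, mul_zero, Finset.sum_ite_eq', Finset.mem_univ, if_true]
    linarith
  rintro ⟨u, y⟩ ⟨hu, hy, hle⟩ hne
  simp only at hu hy hle
  have hy0 : ∀ s, 0 ≤ y s := fun s => by
    obtain ⟨n, hn⟩ := hy s
    exact hn ▸ n.cast_nonneg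
  have hky : ∀ s, 0 ≤ k s * y s := fun s =>
    mul_nonneg (by simp only [k]; split_ifs <;> linarith) (hy0 s)
  have hux : ∀ q, 0 ≤ (r + 1) * (1 - 2 * x q) * (u q - x q) := by
    intro q
    rcases hx q with h | h <;> rcases hu q with h' | h' <;> rw [h, h'] <;> linarith
  have hfp : f (x, Pi.single t r) = ∑ q, (r + 1) * (1 - 2 * x q) * x q + r := by
    rw [hf]
    simp [Pi.single_apply, k]
  have hfz : f (u, y) = ∑ q, (r + 1) * (1 - 2 * x q) * x q +
      ∑ q, (r + 1) * (1 - 2 * x q) * (u q - x q) + ∑ s, k s * y s := by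
    rw [hf, ← Finset.sum_add_distrib]
    congr 1
    exact Finset.sum_congr rfl fun q _ => by ring
  rw [hfp, hfz]
  have hsum_u := Finset.sum_nonneg fun q (_ : q ∈ Finset.univ) => hux q
  have hsum_y := Finset.sum_nonneg fun s (_ : s ∈ Finset.univ) => hky s
  by_cases hxu : u = x
  · subst hxu
    by_cases hoff : ∃ s, s ≠ t ∧ y s ≠ 0
    · obtain ⟨s, hst, hys⟩ := hoff
      have h1 : 1 ≤ y s := by
        obtain ⟨n, hn⟩ := hy s
        rw [hn] at hys ⊢
        exact_mod_cast Nat.one_le_iff_ne_zero.mpr (by exact_mod_cast hys)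
      have h2 := Finset.single_le_sum (fun s _ => hky s) (Finset.mem_univ s)
      have h3 : k s = r + 1 := if_neg hst
      rw [h3] at h2
      nlinarith
    · push Not at hoff
      obtain ⟨n, hn⟩ := hy t
      have hyt : y = Pi.single t (n : ℝ) := by
        ext s
        by_cases hs : s = t
        · subst hs
          simpa using hn
        · simp [hs, hoff s hs]
      subst hyt
      simp only [Pi.single_apply, mul_ite, mul_zero, Finset.sum_ite_eq', Finset.mem_univ,
        if_true] at hle hsum_y ⊢
      have hkt : k t = 1 := if_pos rfl
      have hrn : r < n := lt_of_le_of_ne (hrmin n (by linarith)) fun h => hne (by rw [h])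
      rw [hkt]
      linarith
  · obtain ⟨q, hq⟩ := Function.ne_iff.mp hxu
    have h1 : (r + 1) * (1 - 2 * x q) * (u q - x q) = r + 1 := by
      rcases hx q with h | h <;> rcases hu q with h' | h' <;> rw [h, h'] at hq ⊢ <;>
        first | exact absurd rfl hq | ring
    have h2 := Finset.single_le_sum (fun q _ => hux q) (Finset.mem_univ q)
    linarith
end

section
/- Let α^⊤x ≤ β^⊤y + γ be a nontrivial facet-defining inequality of P. Then for every q ∈ Q and every t ∈ T one has α_q ≥ 0 and α_q ≤ ⌈a_q / b_t⌉ · β_t. -/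
open scoped BigOperators

/-- The inequality `α᳐x ≤ β᳐y + γ` is valid for `P` (equivalently, holds on `X`). -/
def ufValid {Q T : Type*} [Fintype Q] [Fintype T] (a : Q → ℝ) (b : T → ℝ) (c : ℝ)
    (α : Q → ℝ) (β : T → ℝ) (γ : ℝ) : Prop :=
  ∀ p ∈ ufX a b c, ∑ q, α q * p.1 q ≤ ∑ t, β t * p.2 t + γ

/-- The inequality `α᳐x ≤ β᳐y + γ` is facet-defining for `P`: it is valid and the
face `F = {(x,y) ∈ P : α᳐x = β᳐y + γ}` contains `|Q| + |T|` affinely independent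
points. -/
noncomputable def ufFacet {Q T : Type*} [Fintype Q] [Fintype T]
    (a : Q → ℝ) (b : T → ℝ) (c : ℝ) (α : Q → ℝ) (β : T → ℝ) (γ : ℝ) : Prop :=
  ufValid a b c α β γ ∧
  ∃ pts : Fin (Fintype.card Q + Fintype.card T) → (Q → ℝ) × (T → ℝ),
    (∀ i, pts i ∈ ufP a b c ∧
      ∑ q, α q * (pts i).1 q = ∑ t, β t * (pts i).2 t + γ) ∧
    AffineIndependent ℝ pts

/-- The inequality `α᳐x ≤ β᳐y + γ` is nontrivial: it is not a positive scalar
multiple of any of `−x_q ≤ 0`, `x_q ≤ 1`, `−y_t ≤ 0`, or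
`Σ a_q x_q − Σ b_t y_t ≤ c`. -/
def ufNontrivial {Q T : Type*} [Fintype Q] [Fintype T] [DecidableEq Q] [DecidableEq T]
    (a : Q → ℝ) (b : T → ℝ) (c : ℝ) (α : Q → ℝ) (β : T → ℝ) (γ : ℝ) : Prop :=
  ¬ ∃ μ : ℝ, 0 < μ ∧
    ((∃ q : Q, α = -(μ • (Pi.single q (1 : ℝ) : Q → ℝ)) ∧ β = 0 ∧ γ = 0) ∨
     (∃ q : Q, α = μ • (Pi.single q (1 : ℝ) : Q → ℝ) ∧ β = 0 ∧ γ = μ) ∨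
     (∃ t : T, α = 0 ∧ β = μ • (Pi.single t (1 : ℝ) : T → ℝ) ∧ γ = 0) ∨
     (α = μ • a ∧ β = μ • b ∧ γ = μ * c))

/-- A linear inequality that holds on `X` holds on `P`. -/
lemma le_of_mem_ufP {Q T : Type*} [Fintype Q] [Fintype T] {a : Q → ℝ} {b : T → ℝ} {c : ℝ}
    (f : ((Q → ℝ) × (T → ℝ)) →ₗ[ℝ] ℝ) (r : ℝ) (h : ∀ p ∈ ufX a b c, f p ≤ r) :
    ∀ p ∈ ufP a b c, f p ≤ r := fun _ hp =>
  convexHull_min (t := {p | f p ≤ r}) h (convex_halfSpace_le f.isLinear r) hp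

/-- The linear functional `(x, y) ↦ α᳐x - β᳐y`. -/
noncomputable def ufFunctional {Q T : Type*} [Fintype Q] [Fintype T] (α : Q → ℝ) (β : T → ℝ) :
    ((Q → ℝ) × (T → ℝ)) →ₗ[ℝ] ℝ :=
  (Fintype.linearCombination ℝ α).comp (LinearMap.fst ℝ _ _) -
    (Fintype.linearCombination ℝ β).comp (LinearMap.snd ℝ _ _)

lemma ufFunctional_apply {Q T : Type*} [Fintype Q] [Fintype T] (α : Q → ℝ) (β : T → ℝ)
    (p : (Q → ℝ) × (T → ℝ)) :
    ufFunctional α β p = ∑ q, α q * p.1 q - ∑ t, β t * p.2 t := by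
  simp [ufFunctional, Fintype.linearCombination_apply, mul_comm]

/-- The coordinate functional `(x, y) ↦ x_q`. -/
def ufCoord {Q : Type*} (T : Type*) (q : Q) : ((Q → ℝ) × (T → ℝ)) →ₗ[ℝ] ℝ :=
  (LinearMap.proj q).comp (LinearMap.fst ℝ _ _)

@[simp]
lemma ufCoord_apply {Q T : Type*} (q : Q) (p : (Q → ℝ) × (T → ℝ)) : ufCoord T q p = p.1 q := rfl

/-- A functional that is constant on `dim E` affinely independent points of a hyperplane `g = k`
is a multiple of `g`. -/
lemma eq_smul_of_affineIndependent {E : Type*} [AddCommGroup E] [Module ℝ E]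
    [FiniteDimensional ℝ E] {n : ℕ} (hn : Module.finrank ℝ E = n + 1) {pts : Fin (n + 1) → E}
    (hpts : AffineIndependent ℝ pts) {f g : E →ₗ[ℝ] ℝ} {k r : ℝ}
    (hf : ∀ i, f (pts i) = r) (hg : ∀ i, g (pts i) = k) {e : E} (he : g e = 1) (v : E) :
    f v = f e * g v := by
  have le_ker : ∀ {h : E →ₗ[ℝ] ℝ} {s : ℝ}, (∀ i, h (pts i) = s) →
      vectorSpan ℝ (Set.range pts) ≤ LinearMap.ker h := by
    intro h s hs
    rw [vectorSpan_def, Submodule.span_le]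
    rintro _ ⟨_, ⟨i, rfl⟩, _, ⟨j, rfl⟩, rfl⟩
    simp [hs]
  have hV : Module.finrank ℝ (vectorSpan ℝ (Set.range pts)) = n :=
    hpts.finrank_vectorSpan (Fintype.card_fin _)
  have hg0 : g ≠ 0 := by
    rintro rfl
    simp at he
  have hker : Module.finrank ℝ (LinearMap.ker g) = n := by
    have := Module.Dual.finrank_ker_add_one_of_ne_zero (f := g) hg0
    omega
  have heq := Submodule.eq_of_le_of_finrank_eq (le_ker hg) (hV.trans hker.symm)
  have hmem : v - g v • e ∈ LinearMap.ker g := by simp [he]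
  have := le_ker hf (heq ▸ hmem)
  rw [LinearMap.mem_ker, map_sub, map_smul, smul_eq_mul] at this
  linarith

/-- A facet contained in the hyperplane `x_q = k` is defined by a multiple of `x_q = k`. -/
lemma eq_single_of_facet_subset {Q T : Type*} [Fintype Q] [Fintype T] [DecidableEq Q] [Nonempty T]
    {a : Q → ℝ} {b : T → ℝ} {c : ℝ} {α : Q → ℝ} {β : T → ℝ} {γ : ℝ}
    (hfacet : ufFacet a b c α β γ) (q : Q) (k : ℝ)
    (h : ∀ p ∈ ufP a b c, ufFunctional α β p = γ → p.1 q = k) :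
    α = α q • (Pi.single q (1 : ℝ) : Q → ℝ) ∧ β = 0 ∧ γ = α q * k := by
  classical
  obtain ⟨-, pts, hpts, hind⟩ := hfacet
  obtain ⟨n, hn⟩ : ∃ n, Fintype.card Q + Fintype.card T = n + 1 :=
    Nat.exists_eq_succ_of_ne_zero (by have := Fintype.card_pos (α := T); omega)
  have hdim : Module.finrank ℝ ((Q → ℝ) × (T → ℝ)) = n + 1 := by simp [← hn]
  generalize Fintype.card Q + Fintype.card T = m at *
  subst hn
  have hf : ∀ i, ufFunctional α β (pts i) = γ := fun i => by
    rw [ufFunctional_apply, (hpts i).2]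
    ring
  have hg : ∀ i, ufCoord T q (pts i) = k := fun i => h _ (hpts i).1 (hf i)
  have hmul := eq_smul_of_affineIndependent hdim hind hf hg
    (e := (Pi.single q 1, 0)) (by simp)
  have hαq : ufFunctional α β (Pi.single q 1, 0) = α q := by
    simp [ufFunctional_apply, Pi.single_apply]
  rw [hαq] at hmul
  refine ⟨funext fun r => ?_, funext fun t => ?_, ?_⟩
  · simpa [ufFunctional_apply, Pi.single_apply, eq_comm] using hmul (Pi.single r 1, 0)
  · simpa [ufFunctional_apply, Pi.single_apply] using hmul (0, Pi.single t 1)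
  · rw [← hf 0, hmul, hg]

lemma sum_mul_update {ι : Type*} [Fintype ι] [DecidableEq ι] (w x : ι → ℝ) (i : ι) (r : ℝ) :
    ∑ j, w j * Function.update x i r j = ∑ j, w j * x j + w i * (r - x i) := by
  have : ∀ j, w j * Function.update x i r j = w j * x j + if j = i then w i * (r - x i) else 0 := by
    intro j
    by_cases h : j = i
    · subst h
      simp
      ring
    · simp [h]
  simp [this, Finset.sum_add_distrib]

/-- Switching off a commodity preserves feasibility. -/
lemma update_zero_mem_ufX {Q T : Type*} [Fintype Q] [Fintype T] [DecidableEq Q]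
    {a : Q → ℝ} {b : T → ℝ} {c : ℝ} {q : Q} (ha : 0 ≤ a q) {p : (Q → ℝ) × (T → ℝ)}
    (hp : p ∈ ufX a b c) : (Function.update p.1 q 0, p.2) ∈ ufX a b c := by
  obtain ⟨hx, hy, hle⟩ := hp
  refine ⟨fun r => ?_, hy, ?_⟩
  · by_cases h : r = q
    · subst h
      simp
    · simpa [h] using hx r
  · simp only [sum_mul_update]
    rcases hx q with h | h <;> rw [h] <;> linarith

/-- Switching on a commodity and paying for it with enough units of one facility preserves
feasibility. -/
lemma update_one_mem_ufX {Q T : Type*} [Fintype Q] [Fintype T] [DecidableEq Q] [DecidableEq T]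
    {a : Q → ℝ} {b : T → ℝ} {c : ℝ} {q : Q} {t : T} {n : ℕ} (hn : a q ≤ b t * n)
    {p : (Q → ℝ) × (T → ℝ)} (hp : p ∈ ufX a b c) (hq : p.1 q = 0) :
    (Function.update p.1 q 1, Function.update p.2 t (p.2 t + n)) ∈ ufX a b c := by
  obtain ⟨hx, hy, hle⟩ := hp
  refine ⟨fun r => ?_, fun s => ?_, ?_⟩
  · by_cases h : r = q
    · subst h
      simp
    · simpa [h] using hx r
  · by_cases h : s = t
    · subst h
      obtain ⟨m, hm⟩ := hy s
      exact ⟨m + n, by simp [hm]⟩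
    · simpa [h] using hy s
  · simp only [sum_mul_update, hq]
    linarith

lemma nonneg_of_mem_ufP {Q T : Type*} [Fintype Q] [Fintype T] {a : Q → ℝ} {b : T → ℝ} {c : ℝ}
    {p : (Q → ℝ) × (T → ℝ)} (hp : p ∈ ufP a b c) (q : Q) : 0 ≤ p.1 q := by
  have := le_of_mem_ufP (-ufCoord T q) 0
    (fun p hp => by rcases hp.1 q with h | h <;> simp [h]) p hp
  simpa using this

lemma le_one_of_mem_ufP {Q T : Type*} [Fintype Q] [Fintype T] {a : Q → ℝ} {b : T → ℝ} {c : ℝ}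
    {p : (Q → ℝ) × (T → ℝ)} (hp : p ∈ ufP a b c) (q : Q) : p.1 q ≤ 1 :=
  le_of_mem_ufP (ufCoord T q) 1 (fun p hp => by rcases hp.1 q with h | h <;> simp [h]) p hp

/-- for a nontrivial facet-defining inequality `α᳐x ≤ β᳐y + γ` of
`P`, one has `α_q ≥ 0` and `α_q ≤ ⌈a_q / b_t⌉ β_t` for every `q ∈ Q`, `t ∈ T`. -/
theorem ufFacet_alpha_bounds {Q T : Type*} [Fintype Q] [Fintype T]
    [DecidableEq Q] [DecidableEq T]
    (a : Q → ℝ) (b : T → ℝ) (c : ℝ) (t1 : T)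
    (ha : ∀ q, 0 < a q) (hb : ∀ t, 0 < b t) (hb1 : ∀ t, b t1 ≤ b t)
    (hc : 0 < ∑ q, a q - c)
    (α : Q → ℝ) (β : T → ℝ) (γ : ℝ)
    (hfacet : ufFacet a b c α β γ)
    (hnt : ufNontrivial a b c α β γ) :
    ∀ (q : Q) (t : T), 0 ≤ α q ∧ α q ≤ ((⌈a q / b t⌉ : ℤ) : ℝ) * β t := by
  intro q t
  have : Nonempty T := ⟨t1⟩
  have hvalid := hfacet.1
  constructor
  · by_contra! hneg
    have hface : ∀ p ∈ ufP a b c, ufFunctional α β p = γ → p.1 q = 0 := by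
      intro p hp htight
      have hle := le_of_mem_ufP (ufFunctional α β - α q • ufCoord T q) γ (fun p hp => by
        have := hvalid _ (update_zero_mem_ufX (q := q) (ha q).le hp)
        simp only [sum_mul_update] at this
        simp only [LinearMap.sub_apply, LinearMap.smul_apply, ufFunctional_apply, ufCoord_apply,
          smul_eq_mul]
        linarith) p hp
      simp only [LinearMap.sub_apply, LinearMap.smul_apply, htight, ufCoord_apply,
        smul_eq_mul] at hle
      nlinarith [nonneg_of_mem_ufP hp q]
    obtain ⟨hα, hβ, hγ⟩ := eq_single_of_facet_subset hfacet q 0 hface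
    refine hnt ⟨-α q, by linarith, Or.inl ⟨q, ?_, hβ, by simpa using hγ⟩⟩
    rwa [neg_smul, neg_neg]
  · by_contra! hlt
    obtain ⟨n, hn⟩ := Int.eq_ofNat_of_zero_le (Int.ceil_nonneg (div_pos (ha q) (hb t)).le)
    rw [hn, Int.cast_natCast] at hlt
    have hpay : a q ≤ b t * n := by
      have := Int.le_ceil (a q / b t)
      rw [hn, Int.cast_natCast, div_le_iff₀ (hb t)] at this
      linarith
    have hface : ∀ p ∈ ufP a b c, ufFunctional α β p = γ → p.1 q = 1 := by
      intro p hp htight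
      have hle := le_of_mem_ufP (ufFunctional α β - (α q - n * β t) • ufCoord T q)
        (γ - (α q - n * β t)) (fun p hp => by
          simp only [LinearMap.sub_apply, LinearMap.smul_apply, ufFunctional_apply,
            ufCoord_apply, smul_eq_mul]
          rcases hp.1 q with h | h
          · have := hvalid _ (update_one_mem_ufX hpay hp h)
            simp only [sum_mul_update, h] at this
            rw [h]
            linarith
          · have := hvalid p hp
            rw [h]
            linarith) p hp
      simp only [LinearMap.sub_apply, LinearMap.smul_apply, htight, ufCoord_apply,
        smul_eq_mul] at hle
      nlinarith [le_one_of_mem_ufP hp q]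
    obtain ⟨hα, hβ, hγ⟩ := eq_single_of_facet_subset hfacet q 1 hface
    refine hnt ⟨α q, by simpa [hβ] using hlt, Or.inr (Or.inl ⟨q, hα, hβ, by simpa using hγ⟩)⟩
end

section
/- Let α^⊤x ≤ β^⊤y + γ be a nontrivial facet-defining inequality of P. If c ≥ 0 then γ ≥ 0; if c < 0 then γ ≥ −⌈−c / b_t⌉ · β_t for every t ∈ T. -/
open scoped BigOperators

/-- for a nontrivial facet-defining inequality `α᳐x ≤ β᳐y + γ` of
`P`: if `c ≥ 0` then `γ ≥ 0`; if `c < 0` then `γ ≥ −⌈−c/b_t⌉ β_t` for every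
`t ∈ T`. -/
theorem ufFacet_gamma_bounds {Q T : Type*} [Fintype Q] [Fintype T]
    [DecidableEq Q] [DecidableEq T]
    (a : Q → ℝ) (b : T → ℝ) (c : ℝ) (t1 : T)
    (ha : ∀ q, 0 < a q) (hb : ∀ t, 0 < b t) (hb1 : ∀ t, b t1 ≤ b t)
    (hc : 0 < ∑ q, a q - c)
    (α : Q → ℝ) (β : T → ℝ) (γ : ℝ)
    (hfacet : ufFacet a b c α β γ)
    (hnt : ufNontrivial a b c α β γ) :
    (0 ≤ c → 0 ≤ γ) ∧
    (c < 0 → ∀ t : T, -(((⌈-c / b t⌉ : ℤ) : ℝ) * β t) ≤ γ) := by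
  obtain ⟨hvalid, -⟩ := hfacet
  refine ⟨fun hc0 => ?_, fun hc0 t => ?_⟩
  · simpa using hvalid (0, 0) ⟨fun q => Or.inl rfl, fun t => ⟨0, by simp⟩, by simpa using hc0⟩
  · have hpos : 0 ≤ -c / b t := div_nonneg (by linarith) (hb t).le
    obtain ⟨k, hk⟩ := Int.eq_ofNat_of_zero_le (Int.ceil_nonneg hpos)
    have hle : -c / b t ≤ k := by simpa [hk] using Int.le_ceil (-c / b t)
    have hcap : 0 ≤ b t * k + c := by
      have := (div_le_iff₀ (hb t)).mp hle
      linarith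
    have hineq := hvalid (0, Pi.single t (k : ℝ))
      ⟨fun q => Or.inl rfl,
        fun s => ⟨(Pi.single t k : T → ℕ) s, by
          by_cases h : s = t
          · subst h; simp
          · simp [h]⟩,
        by simpa [Pi.single_apply] using hcap⟩
    have hsum : 0 ≤ β t * k + γ := by simpa [Pi.single_apply] using hineq
    rw [hk, Int.cast_natCast]
    linarith
end

section
/- Given a point (x̄, ȳ) ∈ X_LP, the separation feasible set S = {(α, β, γ) ∈ ℝ^Q × ℝ^T × ℝ : β_1 = 1, β_t ≥ 0 for all t ∈ T, and α^⊤x ≤ β^⊤y + γ for all (x,y) ∈ X} is nonempty (it contains (0, f^1, 0)), and the objective function (α, β, γ) ↦ x̄^⊤α − ȳ^⊤β − γ is bounded above on S. -/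
open scoped BigOperators

/-- The linear relaxation `X_LP` of `X`. -/
def ufXLP {Q T : Type*} [Fintype Q] [Fintype T] (a : Q → ℝ) (b : T → ℝ) (c : ℝ) :
    Set ((Q → ℝ) × (T → ℝ)) :=
  {p | (∀ q, 0 ≤ p.1 q ∧ p.1 q ≤ 1) ∧ (∀ t, 0 ≤ p.2 t) ∧
    ∑ q, a q * p.1 q ≤ ∑ t, b t * p.2 t + c}

/-- The separation feasible set
`S = {(α,β,γ) : β_1 = 1, β ≥ 0, α᳐x ≤ β᳐y + γ for all (x,y) ∈ X}`. -/
def sepS {Q T : Type*} [Fintype Q] [Fintype T] (a : Q → ℝ) (b : T → ℝ) (c : ℝ)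
    (t1 : T) : Set ((Q → ℝ) × (T → ℝ) × ℝ) :=
  {s | s.2.1 t1 = 1 ∧ (∀ t, 0 ≤ s.2.1 t) ∧
    ∀ p ∈ ufX a b c, ∑ q, s.1 q * p.1 q ≤ ∑ t, s.2.1 t * p.2 t + s.2.2}

/-- for `(xb, yb) ∈ X_LP`, the separation feasible set `S` is
nonempty (it contains `(0, f¹, 0)`) and the objective
`(α,β,γ) ↦ xb᳐α − yb᳐β − γ` is bounded above on `S`. -/
theorem sepS_nonempty_bddAbove {Q T : Type*} [Fintype Q] [Fintype T] [DecidableEq T]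
    (a : Q → ℝ) (b : T → ℝ) (c : ℝ) (t1 : T)
    (ha : ∀ q, 0 < a q) (hb : ∀ t, 0 < b t) (hb1 : ∀ t, b t1 ≤ b t)
    (hc : 0 < ∑ q, a q - c)
    (xb : Q → ℝ) (yb : T → ℝ) (hxy : (xb, yb) ∈ ufXLP a b c) :
    (((0 : Q → ℝ), (Pi.single t1 (1 : ℝ) : T → ℝ), (0 : ℝ)) ∈ sepS a b c t1) ∧
    ∃ M : ℝ, ∀ s ∈ sepS a b c t1,
      ∑ q, xb q * s.1 q - ∑ t, yb t * s.2.1 t - s.2.2 ≤ M := by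
  classical
  obtain ⟨hx, hy, -⟩ := hxy
  refine ⟨⟨by simp, fun t => ?_, fun p hp => ?_⟩, ?_⟩
  · by_cases h : t = t1
    · subst h; simp
    · simp [h]
  · obtain ⟨n, hn⟩ := hp.2.1 t1
    simp [Pi.single_apply, hn]
  · obtain ⟨N, hN⟩ := exists_nat_ge ((∑ q, a q - c) / b t1)
    rw [div_le_iff₀ (hb t1)] at hN
    refine ⟨N, ?_⟩
    rintro ⟨α, β, γ⟩ ⟨hβ1, hβ, hval⟩
    -- The maximizer of `α` over the cube, paired with enough capacity on `t1`, lies in `X`.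
    have hmem : ((fun q => if 0 < α q then (1 : ℝ) else 0), Pi.single t1 (N : ℝ)) ∈ ufX a b c := by
      refine ⟨fun q => ?_, fun t => ?_, ?_⟩
      · by_cases h : 0 < α q <;> simp [h]
      · by_cases h : t = t1
        · subst h; exact ⟨N, by simp⟩
        · exact ⟨0, by simp [h]⟩
      · have hle : ∑ q, a q * (if 0 < α q then (1 : ℝ) else 0) ≤ ∑ q, a q := by
          refine Finset.sum_le_sum fun q _ => ?_
          split_ifs <;> linarith [ha q]
        have hsum : ∑ t, b t * (Pi.single t1 (N : ℝ) : T → ℝ) t = b t1 * N := by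
          simp [Pi.single_apply]
        dsimp only
        rw [hsum]
        linarith
    have hvertex := hval _ hmem
    have hsum : ∑ t, β t * (Pi.single t1 (N : ℝ) : T → ℝ) t = N := by
      have h1 : β t1 = 1 := hβ1
      simp [Pi.single_apply, h1]
    dsimp only at hvertex ⊢
    rw [hsum] at hvertex
    have hcube : ∑ q, xb q * α q ≤ ∑ q, α q * (if 0 < α q then (1 : ℝ) else 0) := by
      refine Finset.sum_le_sum fun q _ => ?_
      obtain ⟨h0, h1⟩ := hx q
      dsimp only at h0 h1
      split_ifs with h <;> nlinarith
    have hcost : 0 ≤ ∑ t, yb t * β t :=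
      Finset.sum_nonneg fun t _ => mul_nonneg (hy t) (hβ t)
    linarith
end

section
/- Given a point (x̄, ȳ) ∈ X_LP, let (α, β, γ) be an extreme point of the separation feasible set S that maximizes the objective x̄^⊤α − ȳ^⊤β − γ over S. Then the inequality α^⊤x ≤ β^⊤y + γ is facet-defining for P. -/
open scoped BigOperators

open scoped Pointwise in
/-- The positive values of the slack of `α᳐x ≤ β᳐y + γ` over `X` are bounded away from `0`. -/
theorem exists_pos_le_slack {Q T : Type*} [Fintype Q] [Fintype T]
    (a : Q → ℝ) (b : T → ℝ) (c : ℝ) (α : Q → ℝ) (β : T → ℝ) (γ : ℝ) (hβ : ∀ t, 0 ≤ β t) :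
    ∃ σ > 0, ∀ p ∈ ufX a b c, 0 < ∑ t, β t * p.2 t + γ - ∑ q, α q * p.1 q →
      σ ≤ ∑ t, β t * p.2 t + γ - ∑ q, α q * p.1 q := by
  have hA : (Set.range fun n : T → ℕ => ∑ t, β t * (n t : ℝ)).IsPWO := by
    rw [← Set.image_univ]
    refine (Set.isPWO_of_wellQuasiOrderedLE Set.univ).image_of_monotone fun m n hmn => ?_
    exact Finset.sum_le_sum fun t _ =>
      mul_le_mul_of_nonneg_left (Nat.cast_le.2 (hmn t)) (hβ t)
  have hB : (Set.range fun e : Q → Bool =>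
      γ - ∑ q, α q * (if e q then (1 : ℝ) else 0)).IsPWO :=
    (Set.finite_range _).isPWO
  have hwf := ((hA.add hB).mono (Set.inter_subset_left (t := Set.Ioi 0))).isWF
  have hmem : ∀ p ∈ ufX a b c, 0 < ∑ t, β t * p.2 t + γ - ∑ q, α q * p.1 q →
      ∑ t, β t * p.2 t + γ - ∑ q, α q * p.1 q ∈
        ((Set.range fun n : T → ℕ => ∑ t, β t * (n t : ℝ)) +
          (Set.range fun e : Q → Bool => γ - ∑ q, α q * (if e q then (1 : ℝ) else 0))) ∩
            Set.Ioi 0 := by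
    rintro p ⟨hx, hy, -⟩ hp
    choose n hn using hy
    refine ⟨Set.mem_add.2 ⟨_, ⟨n, rfl⟩, _, ⟨fun q => decide (p.1 q = 1), rfl⟩, ?_⟩, hp⟩
    have h1 : ∀ q, (if decide (p.1 q = 1) = true then (1 : ℝ) else 0) = p.1 q := by
      intro q
      rcases hx q with h | h <;> simp [h]
    simp only [h1, ← hn]
    ring
  by_cases hne : (((Set.range fun n : T → ℕ => ∑ t, β t * (n t : ℝ)) +
      (Set.range fun e : Q → Bool => γ - ∑ q, α q * (if e q then (1 : ℝ) else 0))) ∩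
        Set.Ioi 0).Nonempty
  · exact ⟨hwf.min hne, (hwf.min_mem hne).2, fun p hp h => hwf.min_le hne (hmem p hp h)⟩
  · exact ⟨1, one_pos, fun p hp h => (hne ⟨_, hmem p hp h⟩).elim⟩

/-- A direction that vanishes on all constraints of `S` active at `s` can be followed for a
positive time in both senses. -/
theorem exists_add_sub_smul_mem_sepS {Q T : Type*} [Fintype Q] [Fintype T]
    {a : Q → ℝ} {b : T → ℝ} {c : ℝ} {t1 : T} {s : (Q → ℝ) × (T → ℝ) × ℝ}
    (hs : s ∈ sepS a b c t1) (d : (Q → ℝ) × (T → ℝ) × ℝ) (hd1 : d.2.1 t1 = 0)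
    (hd0 : ∀ t, s.2.1 t = 0 → d.2.1 t = 0)
    (hd : ∀ p ∈ ufX a b c, ∑ q, s.1 q * p.1 q = ∑ t, s.2.1 t * p.2 t + s.2.2 →
      ∑ q, d.1 q * p.1 q = ∑ t, d.2.1 t * p.2 t + d.2.2) :
    ∃ ε > (0 : ℝ), s + ε • d ∈ sepS a b c t1 ∧ s - ε • d ∈ sepS a b c t1 := by
  obtain ⟨α, β, γ⟩ := s
  obtain ⟨α', β', γ'⟩ := d
  obtain ⟨h1, hβ, hval⟩ := hs
  dsimp only at *
  obtain ⟨σ, hσ, hσle⟩ := exists_pos_le_slack a b c α β γ hβ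
  obtain ⟨K, hK0, hK⟩ : ∃ K, 0 ≤ K ∧ ∀ t, |β' t| ≤ K * β t := by
    refine ⟨∑ t, |β' t| / β t,
      Finset.sum_nonneg fun t _ => div_nonneg (abs_nonneg _) (hβ t), fun t => ?_⟩
    rcases (hβ t).eq_or_lt with h | h
    · simp [hd0 t h.symm, ← h]
    · rw [← div_le_iff₀ h]
      exact Finset.single_le_sum (f := fun t => |β' t| / β t)
        (fun t _ => div_nonneg (abs_nonneg _) (hβ t)) (Finset.mem_univ t)
  have hx_bound : ∀ p ∈ ufX a b c, ∀ f : Q → ℝ, |∑ q, f q * p.1 q| ≤ ∑ q, |f q| := by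
    intro p hp f
    refine (Finset.abs_sum_le_sum_abs _ _).trans (Finset.sum_le_sum fun q _ => ?_)
    rcases hp.1 q with h | h <;> simp [h]
  have hy_bound : ∀ p ∈ ufX a b c, |∑ t, β' t * p.2 t| ≤ K * ∑ t, β t * p.2 t := by
    intro p hp
    rw [Finset.mul_sum]
    refine (Finset.abs_sum_le_sum_abs _ _).trans (Finset.sum_le_sum fun t _ => ?_)
    obtain ⟨n, hn⟩ := hp.2.1 t
    rw [hn, abs_mul, Nat.abs_cast, ← mul_assoc]
    exact mul_le_mul_of_nonneg_right (hK t) n.cast_nonneg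
  set L := K * (|γ| + ∑ q, |α q|) + |γ'| + ∑ q, |α' q| with hL
  have hL0 : 0 ≤ L := by positivity
  have hM0 : 0 ≤ K + L / σ := by positivity
  have hmain : ∀ p ∈ ufX a b c, |∑ t, β' t * p.2 t + γ' - ∑ q, α' q * p.1 q| ≤
      (K + L / σ + 1) * (∑ t, β t * p.2 t + γ - ∑ q, α q * p.1 q) := by
    intro p hp
    have hslack := hval p hp
    rcases hslack.eq_or_lt with h | h
    · rw [hd p hp h, h]
      simp
    · have hσp := hσle p hp (sub_pos.2 h)
      have e1 := hx_bound p hp α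
      have e2 := hx_bound p hp α'
      have e3 := hy_bound p hp
      have e4 : K * (∑ t, β t * p.2 t) ≤
          K * ((∑ t, β t * p.2 t + γ - ∑ q, α q * p.1 q) + (|γ| + ∑ q, |α q|)) := by
        refine mul_le_mul_of_nonneg_left ?_ hK0
        linarith [neg_abs_le γ, (abs_le.1 e1).2]
      have e5 : L ≤ L / σ * (∑ t, β t * p.2 t + γ - ∑ q, α q * p.1 q) := by
        rw [div_mul_eq_mul_div, le_div_iff₀ hσ]
        exact mul_le_mul_of_nonneg_left hσp hL0
      have e6 := abs_le.1 e2
      have e7 := abs_le.1 e3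
      rw [abs_le]
      constructor <;> linarith [neg_abs_le γ', le_abs_self γ']
  have hpos : 0 < K + L / σ + 1 := by positivity
  have hβ' : ∀ t, |β' t| ≤ (K + L / σ + 1) * β t := fun t =>
    (hK t).trans (mul_le_mul_of_nonneg_right
      (by linarith [div_nonneg hL0 hσ.le]) (hβ t))
  have hscale : ∀ {u v : ℝ}, |u| ≤ (K + L / σ + 1) * v →
      -v ≤ (K + L / σ + 1)⁻¹ * u ∧ (K + L / σ + 1)⁻¹ * u ≤ v := by
    intro u v h
    rw [← abs_le, abs_mul, abs_of_pos (inv_pos.2 hpos)]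
    exact (inv_mul_le_iff₀ hpos).2 h
  refine ⟨(K + L / σ + 1)⁻¹, inv_pos.2 hpos, ⟨?_, fun t => ?_, fun p hp => ?_⟩,
    ⟨?_, fun t => ?_, fun p hp => ?_⟩⟩
  · simp [h1, hd1]
  · have := (hscale (hβ' t)).1
    simp only [Prod.snd_add, Prod.fst_add, Prod.smul_snd, Prod.smul_fst, Pi.add_apply,
      Pi.smul_apply, smul_eq_mul]
    linarith
  · have := (hscale (hmain p hp)).1
    simp only [Prod.snd_add, Prod.fst_add, Prod.smul_snd, Prod.smul_fst, Pi.add_apply,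
      Pi.smul_apply, smul_eq_mul, add_mul, Finset.sum_add_distrib, mul_assoc, ← Finset.mul_sum]
    simp only [mul_add, mul_sub] at this
    linarith
  · simp [h1, hd1]
  · have := (hscale (hβ' t)).2
    simp only [Prod.snd_sub, Prod.fst_sub, Prod.smul_snd, Prod.smul_fst, Pi.sub_apply,
      Pi.smul_apply, smul_eq_mul]
    linarith
  · have := (hscale (hmain p hp)).2
    simp only [Prod.snd_sub, Prod.fst_sub, Prod.smul_snd, Prod.smul_fst, Pi.sub_apply,
      Pi.smul_apply, smul_eq_mul, sub_mul, Finset.sum_sub_distrib, mul_assoc, ← Finset.mul_sum]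
    simp only [mul_add, mul_sub] at this
    linarith

/-- At an extreme point of `S`, only the zero direction vanishes on all active constraints. -/
theorem eq_zero_of_mem_extremePoints_sepS {Q T : Type*} [Fintype Q] [Fintype T]
    {a : Q → ℝ} {b : T → ℝ} {c : ℝ} {t1 : T} {s : (Q → ℝ) × (T → ℝ) × ℝ}
    (hs : s ∈ Set.extremePoints ℝ (sepS a b c t1)) (d : (Q → ℝ) × (T → ℝ) × ℝ)
    (hd1 : d.2.1 t1 = 0) (hd0 : ∀ t, s.2.1 t = 0 → d.2.1 t = 0)
    (hd : ∀ p ∈ ufX a b c, ∑ q, s.1 q * p.1 q = ∑ t, s.2.1 t * p.2 t + s.2.2 →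
      ∑ q, d.1 q * p.1 q = ∑ t, d.2.1 t * p.2 t + d.2.2) :
    d = 0 := by
  obtain ⟨ε, hε, hadd, hsub⟩ := exists_add_sub_smul_mem_sepS hs.1 d hd1 hd0 hd
  have h : s + ε • d = s := hs.2 hadd hsub
    ⟨1 / 2, 1 / 2, by norm_num, by norm_num, by norm_num, by module⟩
  exact (smul_eq_zero.1 (add_eq_left.1 h)).resolve_left hε.ne'

/-- Some constraint indexed by `X` is active at an extreme point of `S`. -/
theorem exists_tight_of_mem_extremePoints_sepS {Q T : Type*} [Fintype Q] [Fintype T]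
    {a : Q → ℝ} {b : T → ℝ} {c : ℝ} {t1 : T} {s : (Q → ℝ) × (T → ℝ) × ℝ}
    (hs : s ∈ Set.extremePoints ℝ (sepS a b c t1)) :
    ∃ p ∈ ufX a b c, ∑ q, s.1 q * p.1 q = ∑ t, s.2.1 t * p.2 t + s.2.2 := by
  by_contra! h
  have := eq_zero_of_mem_extremePoints_sepS hs (0, 0, 1) rfl (fun _ _ => rfl)
    fun p hp hp' => (h p hp hp').elim
  simp at this

/-- A linear functional that is constant on the tight points of an extreme point of `S` and
vanishes on the unit vector of `t1` is zero. -/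
theorem functional_eq_zero_of_const_on_tight {Q T : Type*} [Fintype Q] [Fintype T]
    [DecidableEq T] {a : Q → ℝ} {b : T → ℝ} {c : ℝ} {t1 : T} {s : (Q → ℝ) × (T → ℝ) × ℝ}
    (hb : ∀ t, 0 < b t) (hs : s ∈ Set.extremePoints ℝ (sepS a b c t1))
    (f : Module.Dual ℝ ((Q → ℝ) × (T → ℝ))) (g : ℝ)
    (hf : ∀ p ∈ ufX a b c, ∑ q, s.1 q * p.1 q = ∑ t, s.2.1 t * p.2 t + s.2.2 → f p = g)
    (hf1 : f (0, Pi.single t1 1) = 0) : f = 0 := by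
  classical
  have hrep : ∀ p : (Q → ℝ) × (T → ℝ), f p =
      ∑ q, f (Pi.single q 1, 0) * p.1 q + ∑ t, f (0, Pi.single t 1) * p.2 t := by
    rintro ⟨x, y⟩
    have hxy : ((x, y) : (Q → ℝ) × (T → ℝ)) =
        ∑ q, x q • ((Pi.single q 1, 0) : (Q → ℝ) × (T → ℝ)) +
          ∑ t, y t • ((0, Pi.single t 1) : (Q → ℝ) × (T → ℝ)) := by
      ext i <;> simp [Prod.fst_sum, Prod.snd_sum, Finset.sum_apply, Pi.single_apply]
    conv_lhs => rw [hxy]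
    simp only [map_add, map_sum, map_smul, smul_eq_mul, mul_comm]
  obtain ⟨p, hp, hpt⟩ := exists_tight_of_mem_extremePoints_sepS hs
  have hd := eq_zero_of_mem_extremePoints_sepS hs
    (fun q => f (Pi.single q 1, 0), fun t => -f (0, Pi.single t 1), g) (by simp [hf1])
    (fun t ht => ?_) (fun p hp hpt => ?_)
  · simp only [Prod.mk_eq_zero, funext_iff, Pi.zero_apply, neg_eq_zero] at hd
    refine LinearMap.ext fun p => ?_
    rw [hrep p]
    simp only [hd.1, hd.2.1, zero_mul, Finset.sum_const_zero, add_zero, LinearMap.zero_apply]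
  · have hmem : p + (0, Pi.single t 1) ∈ ufX a b c := by
      refine ⟨fun q => by simpa using hp.1 q, fun u => ?_, ?_⟩
      · obtain ⟨n, hn⟩ := hp.2.1 u
        by_cases hu : u = t
        · subst hu
          exact ⟨n + 1, by simp [hn]⟩
        · exact ⟨n, by simp [hn, hu]⟩
      · have := hp.2.2
        have := hb t
        simp only [Prod.fst_add, Prod.snd_add, Pi.add_apply, Pi.zero_apply, mul_add,
          Finset.sum_add_distrib, Finset.sum_const_zero, Pi.single_apply, mul_ite, mul_one,
          mul_zero, Finset.sum_ite_eq', Finset.mem_univ, if_true]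
        linarith
    have h2 := hf _ hmem (by
      simp [mul_add, Finset.sum_add_distrib, Pi.single_apply, ht, hpt])
    rw [map_add, hf p hp hpt] at h2
    simpa using h2
  · have h := hf p hp hpt
    rw [hrep] at h
    simp only [neg_mul, Finset.sum_neg_distrib]
    linarith

/-- if `(α, β, γ)` is an extreme point of the separation feasible
set `S` maximizing the objective `x̄᳐α − ȳ᳐β − γ` over `S`, then the inequality
`α᳐x ≤ β᳐y + γ` is facet-defining for `P`. -/
theorem sepS_extreme_maximizer_facet {Q T : Type*} [Fintype Q] [Fintype T]
    (a : Q → ℝ) (b : T → ℝ) (c : ℝ) (t1 : T)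
    (ha : ∀ q, 0 < a q) (hb : ∀ t, 0 < b t) (hb1 : ∀ t, b t1 ≤ b t)
    (hc : 0 < ∑ q, a q - c)
    (xb : Q → ℝ) (yb : T → ℝ) (hxy : (xb, yb) ∈ ufXLP a b c)
    (s : (Q → ℝ) × (T → ℝ) × ℝ)
    (hext : s ∈ Set.extremePoints ℝ (sepS a b c t1))
    (hopt : ∀ s' ∈ sepS a b c t1,
      ∑ q, xb q * s'.1 q - ∑ t, yb t * s'.2.1 t - s'.2.2 ≤
        ∑ q, xb q * s.1 q - ∑ t, yb t * s.2.1 t - s.2.2) :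
    ufFacet a b c s.1 s.2.1 s.2.2 := by
  classical
  refine ⟨hext.1.2.2, ?_⟩
  set A : Set ((Q → ℝ) × (T → ℝ)) :=
    {p | p ∈ ufX a b c ∧ ∑ q, s.1 q * p.1 q = ∑ t, s.2.1 t * p.2 t + s.2.2}
  obtain ⟨p₀, hp₀, hp₀t⟩ := exists_tight_of_mem_extremePoints_sepS hext
  have hann : Module.finrank ℝ (vectorSpan ℝ A).dualAnnihilator ≤ 1 := by
    rw [← Module.finrank_self ℝ]
    refine LinearMap.finrank_le_finrank_of_injective
      (f := (Module.Dual.eval ℝ _ ((0, Pi.single t1 1) : (Q → ℝ) × (T → ℝ))) ∘ₗ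
        (vectorSpan ℝ A).dualAnnihilator.subtype) ?_
    rw [injective_iff_map_eq_zero]
    rintro ⟨f, hf⟩ hf1
    refine Subtype.ext (functional_eq_zero_of_const_on_tight hb hext f (f p₀)
      (fun p hp hpt => ?_) hf1)
    have := (Submodule.mem_dualAnnihilator f).1 hf _
      (vsub_mem_vectorSpan ℝ (show p ∈ A from ⟨hp, hpt⟩) (show p₀ ∈ A from ⟨hp₀, hp₀t⟩))
    rwa [vsub_eq_sub, map_sub, sub_eq_zero] at this
  have hdim := Subspace.finrank_add_finrank_dualAnnihilator_eq (vectorSpan ℝ A)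
  rw [Module.finrank_prod, Module.finrank_pi, Module.finrank_pi] at hdim
  obtain ⟨B, hBA, hspan, hind⟩ := exists_affineIndependent ℝ ((Q → ℝ) × (T → ℝ)) A
  have : Finite B := finite_of_fin_dim_affineIndependent ℝ hind
  have := Fintype.ofFinite B
  have hBne : B.Nonempty := by
    rw [← affineSpan_nonempty ℝ, hspan, affineSpan_nonempty]
    exact ⟨p₀, hp₀, hp₀t⟩
  have := hBne.to_subtype
  have hcard := hind.finrank_vectorSpan_add_one
  rw [Subtype.range_coe, ← direction_affineSpan, hspan, direction_affineSpan] at hcard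
  replace hcard : Module.finrank ℝ (vectorSpan ℝ A) + 1 = Fintype.card B := hcard
  have hle : Fintype.card (Fin (Fintype.card Q + Fintype.card T)) ≤ Fintype.card B := by
    rw [Fintype.card_fin]
    omega
  obtain ⟨e⟩ := Function.Embedding.nonempty_of_card_le hle
  exact ⟨fun i => e i, fun i => ⟨subset_convexHull ℝ _ (hBA (e i).2).1, (hBA (e i).2).2⟩,
    hind.comp_embedding e⟩
end

section
/- Suppose T = {1}, Q ≠ ∅, a_q ≤ b_1 and b_1·r + c < a_q for all q ∈ Q, and Σ_{q∈Q} a_q ≤ b_1(r + 1) + c. Let (x̄, ȳ) ∈ X_LP and let d ∈ Q maximize x̄_q over q ∈ Q. Then the inequality x_d ≤ y_1 − r is facet-defining for P, and (e^d, 1, −r) is an optimal solution of the separation problem for (x̄, ȳ): for every (α, β_1, γ) with β_1 = 1 such that α^⊤x ≤ β_1 y_1 + γ holds for all (x, y) ∈ X, one has x̄^⊤α − ȳ_1 β_1 − γ ≤ x̄_d − ȳ_1 + r. -/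
open scoped BigOperators

/-- The origin together with the indicators of `{d, q}`, `q ∈ Q`, lifted to heights `r` and
`r + 1`. -/
def liftedPairIndicator {Q T : Type*} [DecidableEq Q] (d : Q) (r : ℝ) :
    Option Q → (Q → ℝ) × (T → ℝ)
  | none => (0, fun _ => r)
  | some q => (fun j => if j = d ∨ j = q then 1 else 0, fun _ => r + 1)

theorem affineIndependent_liftedPairIndicator {Q T : Type*} [Fintype Q] [DecidableEq Q]
    (d : Q) (r : ℝ) :
    AffineIndependent ℝ (liftedPairIndicator d r : Option Q → (Q → ℝ) × (T → ℝ)) := by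
  rw [affineIndependent_iff_of_fintype]
  intro w hw hv
  rw [Finset.univ.weightedVSub_eq_linear_combination hw] at hv
  have hcoord (j : Q) : ∑ q, w (some q) * (if j = d ∨ j = q then 1 else 0) = 0 := by
    have := congrFun (congrArg Prod.fst hv) j
    simpa [liftedPairIndicator, Fintype.sum_option, Prod.fst_sum, Finset.sum_apply] using this
  have hne (q : Q) (hq : q ≠ d) : w (some q) = 0 := by
    simpa [hq] using hcoord q
  have hsum : ∑ q, w (some q) = 0 := by simpa using hcoord d
  have hd : w (some d) = 0 := by
    rwa [Fintype.sum_eq_single d hne] at hsum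
  rintro (_ | q)
  · rwa [Fintype.sum_option, hsum, add_zero] at hw
  · by_cases hq : q = d
    · rw [hq, hd]
    · exact hne q hq

/-- If `0 ≤ δ` and every subset sum of `α` is at most `1 + δ`, then on the unit cube `α` is
bounded by the largest coordinate plus `δ`. -/
theorem sum_mul_le_of_subset_sum_le {Q : Type*} [Fintype Q] {α x : Q → ℝ} {δ m : ℝ}
    (hδ : 0 ≤ δ) (hα : ∀ S : Finset Q, ∑ q ∈ S, α q ≤ 1 + δ) (hx : ∀ q, 0 ≤ x q)
    (hxm : ∀ q, x q ≤ m) (hm0 : 0 ≤ m) (hm1 : m ≤ 1) :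
    ∑ q, x q * α q ≤ m + δ :=
  calc ∑ q, x q * α q
      ≤ ∑ q, m * (if 0 < α q then α q else 0) := by
        refine Finset.sum_le_sum fun q _ => ?_
        split_ifs with h
        · exact mul_le_mul_of_nonneg_right (hxm q) h.le
        · rw [mul_zero]
          exact mul_nonpos_of_nonneg_of_nonpos (hx q) (not_lt.mp h)
    _ = m * ∑ q with 0 < α q, α q := by rw [← Finset.mul_sum, Finset.sum_filter]
    _ ≤ m * (1 + δ) := mul_le_mul_of_nonneg_left (hα _) hm0
    _ ≤ m + δ := by nlinarith

/-- Proposition 5, single facility, condition (5):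
if `T = {1}`, `a_q ≤ b_1` and `b_1 r + c < a_q` for all `q`, and
`Σ a_q ≤ b_1 (r+1) + c`, then for `(x̄,ȳ) ∈ X_LP` and `d` maximizing `x̄_q`,
the inequality `x_d ≤ y_1 − r` is facet-defining for `P` and `(e^d, 1, −r)`
solves the separation problem. -/
theorem single_facility_case1 {Q T : Type*} [Fintype Q] [Fintype T] [Nonempty Q]
    [DecidableEq Q] [DecidableEq T]
    (a : Q → ℝ) (b : T → ℝ) (c : ℝ) (t1 : T) (hT : ∀ t : T, t = t1)
    (ha : ∀ q, 0 < a q) (hb : ∀ t, 0 < b t) (hb1 : ∀ t, b t1 ≤ b t)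
    (hc : 0 < ∑ q, a q - c)
    (r : ℝ) (hr : r = max ((⌈-c / b t1⌉ : ℤ) : ℝ) 0)
    (h1 : ∀ q, a q ≤ b t1) (h2 : ∀ q, b t1 * r + c < a q)
    (h3 : ∑ q, a q ≤ b t1 * (r + 1) + c)
    (xb : Q → ℝ) (yb : T → ℝ) (hxy : (xb, yb) ∈ ufXLP a b c)
    (d : Q) (hd : ∀ q, xb q ≤ xb d) :
    ufFacet a b c (Pi.single d (1 : ℝ)) (Pi.single t1 (1 : ℝ)) (-r) ∧
    ∀ (α : Q → ℝ) (β : T → ℝ) (γ : ℝ), β t1 = 1 →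
      ufValid a b c α β γ →
      ∑ q, xb q * α q - ∑ t, yb t * β t - γ ≤ xb d - yb t1 + r := by
  have hsum (f : T → ℝ) : ∑ t, f t = f t1 :=
    Fintype.sum_eq_single t1 fun t ht => (ht (hT t)).elim
  obtain ⟨n, hn⟩ : ∃ n : ℕ, r = n := by
    refine ⟨⌈-c / b t1⌉.toNat, ?_⟩
    rw [hr, ← Int.cast_natCast, Int.toNat_eq_max]
    push_cast
    rfl
  have hbr : 0 ≤ b t1 * r + c := by
    have h : -c / b t1 ≤ r := hr ▸ (Int.le_ceil _).trans (le_max_left _ _)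
    rw [div_le_iff₀ (hb t1)] at h
    linarith
  have hzero : ((0, fun _ => r) : (Q → ℝ) × (T → ℝ)) ∈ ufX a b c := by
    refine ⟨fun q => Or.inl rfl, fun t => ⟨n, hn⟩, ?_⟩
    simpa [hsum] using hbr
  have hbinary (x : Q → ℝ) (hx : ∀ q, x q = 0 ∨ x q = 1) :
      ((x, fun _ => r + 1) : (Q → ℝ) × (T → ℝ)) ∈ ufX a b c := by
    refine ⟨hx, fun t => ⟨n + 1, by simp [hn]⟩, ?_⟩
    rw [hsum]
    refine le_trans (Finset.sum_le_sum fun q _ => ?_) h3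
    rcases hx q with h | h <;> simp [h, (ha q).le]
  obtain ⟨hx01, -, -⟩ := hxy
  refine ⟨⟨?_, ?_⟩, ?_⟩
  · rintro ⟨x, y⟩ ⟨hx, hy, hxy⟩
    obtain ⟨k, hk⟩ := hy t1
    dsimp only at hx hk hxy ⊢
    rw [hsum, hk] at hxy
    have hax (q : Q) : 0 ≤ a q * x q := by
      rcases hx q with h | h <;> simp [h, (ha q).le]
    suffices x d ≤ k - r by
      simpa [hsum, hk, Pi.single_apply, sub_eq_add_neg] using this
    rcases hx d with h | h
    · have hck : -c / b t1 ≤ k := by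
        rw [div_le_iff₀ (hb t1)]
        linarith [Finset.sum_nonneg fun q (_ : q ∈ Finset.univ) => hax q]
      have hceil : ((⌈-c / b t1⌉ : ℤ) : ℝ) ≤ k := by
        exact_mod_cast Int.ceil_le.mpr (by exact_mod_cast hck)
      have hrk : r ≤ k := hr ▸ max_le hceil k.cast_nonneg
      linarith
    · have had : a d ≤ b t1 * k + c := by
        have := Finset.single_le_sum (fun q _ => hax q) (Finset.mem_univ d)
        rw [h, mul_one] at this
        exact this.trans hxy
      have hrk : r < k := by
        refine lt_of_mul_lt_mul_left ?_ (hb t1).le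
        linarith [h2 d]
      have hnk : (n : ℝ) + 1 ≤ k := by
        rw [hn] at hrk
        exact_mod_cast hrk
      linarith
  · have hcard : Fintype.card (Fin (Fintype.card Q + Fintype.card T)) =
        Fintype.card (Option Q) := by
      rw [Fintype.card_fin, Fintype.card_option, Fintype.card_eq_one_iff.mpr ⟨t1, hT⟩]
    let e := Fintype.equivOfCardEq hcard
    refine ⟨fun i => liftedPairIndicator d r (e i), fun i => ?_,
      (affineIndependent_liftedPairIndicator d r).comp_embedding e.toEmbedding⟩
    dsimp only
    rcases e i with _ | q
    · exact ⟨subset_convexHull ℝ _ hzero, by simp [liftedPairIndicator, hsum]⟩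
    · refine ⟨subset_convexHull ℝ _ (hbinary _ fun j => ?_), ?_⟩
      · split_ifs <;> simp
      · simp [liftedPairIndicator, hsum, Pi.single_apply, -mul_ite]
  · intro α β γ hβ hvalid
    have hγ : 0 ≤ r + γ := by simpa [hsum, hβ] using hvalid _ hzero
    have hα (S : Finset Q) : ∑ q ∈ S, α q ≤ 1 + (r + γ) := by
      have := hvalid _ (hbinary (fun q => if q ∈ S then 1 else 0)
        fun q => by split_ifs <;> simp)
      simp only [hsum, hβ, mul_ite, mul_one, mul_zero, Finset.sum_ite_mem,
        Finset.univ_inter, one_mul] at this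
      linarith
    have := sum_mul_le_of_subset_sum_le hγ hα (fun q => (hx01 q).1) hd (hx01 d).1 (hx01 d).2
    rw [hsum, hβ]
    linarith
end

section
/- Suppose T = {1}, |Q| ≥ 3, a_q ≤ b_1 and b_1·r + c < a_q for all q ∈ Q, and Σ_{q∈Q} a_q − a_{q'} ≤ b_1(r + 1) + c < Σ_{q∈Q} a_q for every q' ∈ Q. Let (x̄, ȳ) ∈ X_LP, let d ∈ Q maximize x̄_q over q ∈ Q, and set s = (Σ_{q∈Q} x̄_q)/(|Q| − 1). Then: if s ≤ x̄_d, the inequality x_d ≤ y_1 − r is an optimal solution of the separation problem for (x̄, ȳ); if x̄_d < s ≤ 1, the inequality (1/(|Q|−1)) Σ_{q∈Q} x_q ≤ y_1 − r is an optimal solution; and if s > 1, the inequality Σ_{q∈Q} x_q ≤ y_1 − r + |Q| − 2 is an optimal solution. Moreover, each of these three inequalities is facet-defining for P. (Here an inequality α^⊤x ≤ β_1 y_1 + γ with β_1 = 1 that is valid for X is an optimal solution of the separation problem for (x̄, ȳ) if x̄^⊤α − ȳ_1 β_1 − γ ≥ x̄^⊤α' − ȳ_1 β_1' − γ' for every (α',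 β_1', γ') with β_1' = 1 and α'^⊤x ≤ β_1' y_1 + γ' valid for all (x,y) ∈ X.) -/
open scoped BigOperators

/-- `(α, β, γ)` (with `β_1 = 1` and valid for `X`) is an optimal solution of the
separation problem for `(x̄, ȳ)`: it maximizes `x̄᳐α − ȳ᳐β − γ` among all valid
triples with `β_1 = 1`. -/
def ufOptSol1 {Q T : Type*} [Fintype Q] [Fintype T]
    (a : Q → ℝ) (b : T → ℝ) (c : ℝ) (t1 : T) (xb : Q → ℝ) (yb : T → ℝ)
    (α : Q → ℝ) (β : T → ℝ) (γ : ℝ) : Prop :=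
  β t1 = 1 ∧ ufValid a b c α β γ ∧
  ∀ (α' : Q → ℝ) (β' : T → ℝ) (γ' : ℝ), β' t1 = 1 → ufValid a b c α' β' γ' →
    ∑ q, xb q * α' q - ∑ t, yb t * β' t - γ' ≤
      ∑ q, xb q * α q - ∑ t, yb t * β t - γ

/-- Valid inequalities give a facet as soon as the face contains a point of `X` together with
`|Q|` further points of `X` whose differences to it are linearly independent. -/
theorem ufFacet_of_linearIndependent {Q T : Type*} [Fintype Q] [Fintype T]
    {a : Q → ℝ} {b : T → ℝ} {c : ℝ} {α : Q → ℝ} {β : T → ℝ} {γ : ℝ}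
    (hcard : Fintype.card T = 1) (hvalid : ufValid a b c α β γ)
    (p : (Q → ℝ) × (T → ℝ)) (f : Q → (Q → ℝ) × (T → ℝ))
    (hp : p ∈ ufX a b c) (hf : ∀ q, f q ∈ ufX a b c)
    (hp_eq : ∑ q, α q * p.1 q = ∑ t, β t * p.2 t + γ)
    (hf_eq : ∀ i, ∑ q, α q * (f i).1 q = ∑ t, β t * (f i).2 t + γ)
    (hli : LinearIndependent ℝ fun q => f q - p) : ufFacet a b c α β γ := by
  refine ⟨hvalid, ?_⟩
  have e : Fin (Fintype.card Q + Fintype.card T) ≃ Option Q :=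
    (Fintype.equivFinOfCardEq (by simp [hcard])).symm
  have hmem : ∀ o : Option Q, o.elim p f ∈ ufX a b c ∧
      ∑ q, α q * (o.elim p f).1 q = ∑ t, β t * (o.elim p f).2 t + γ := by
    rintro (_ | q)
    · exact ⟨hp, hp_eq⟩
    · exact ⟨hf q, hf_eq q⟩
  have haff : AffineIndependent ℝ fun o : Option Q => o.elim p f := by
    rw [affineIndependent_iff_linearIndependent_vsub ℝ _ none]
    have hinj : Function.Injective fun x : {x : Option Q // x ≠ none} =>
        x.1.get (Option.isSome_iff_ne_none.2 x.2) := by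
      intro x y h
      exact Subtype.ext (Option.get_inj.1 h)
    convert hli.comp _ hinj using 1
    · funext ⟨x, hx⟩
      cases x with
      | none => exact absurd rfl hx
      | some q => simp
    · rfl
    · rfl
  exact ⟨fun i => (e i).elim p f,
    fun i => ⟨subset_convexHull ℝ _ (hmem (e i)).1, (hmem (e i)).2⟩,
    haff.comp_embedding e.toEmbedding⟩

/-- A linear functional whose sum over every proper subset of `Q` is at most `M` is at most `t * M`
on the points of `[0, t]^Q` with coordinate sum at most `(|Q| - 1) * t`. -/
theorem sum_mul_le_of_proper_subset_sum_le {Q : Type*} [Fintype Q] [DecidableEq Q] [Nonempty Q]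
    {α x : Q → ℝ} {M t : ℝ}
    (hα : ∀ S : Finset Q, S ≠ Finset.univ → ∑ q ∈ S, α q ≤ M)
    (hx : ∀ q, 0 ≤ x q) (hxt : ∀ q, x q ≤ t)
    (hsum : ∑ q, x q ≤ ((Fintype.card Q : ℝ) - 1) * t) : ∑ q, x q * α q ≤ t * M := by
  obtain ⟨m, hm⟩ := Finite.exists_min α
  have ht : 0 ≤ t := (hx m).trans (hxt m)
  rcases le_or_gt 0 (α m) with h | h
  · have hle : ∑ q, x q * (α q - α m) ≤ ∑ q, t * (α q - α m) :=
      Finset.sum_le_sum fun q _ => mul_le_mul_of_nonneg_right (hxt q) (sub_nonneg.2 (hm q))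
    have hM := hα (Finset.univ.erase m) (Finset.erase_ssubset (Finset.mem_univ m)).ne
    rw [Finset.sum_erase_eq_sub (Finset.mem_univ m)] at hM
    simp only [mul_sub, Finset.sum_sub_distrib, ← Finset.sum_mul, ← Finset.mul_sum,
      Finset.sum_const, Finset.card_univ, nsmul_eq_mul] at hle
    have h₁ := mul_le_mul_of_nonneg_right hsum h
    have h₂ := mul_le_mul_of_nonneg_left hM ht
    linarith
  · let S : Finset Q := Finset.univ.filter fun q => 0 < α q
    have hS : S ≠ Finset.univ := fun hS => by
      have hmem : m ∈ S := hS ▸ Finset.mem_univ m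
      exact absurd (Finset.mem_filter.1 hmem).2 h.le.not_gt
    calc ∑ q, x q * α q ≤ ∑ q, if 0 < α q then t * α q else 0 := by
          refine Finset.sum_le_sum fun q _ => ?_
          split_ifs with hq
          · exact mul_le_mul_of_nonneg_right (hxt q) hq.le
          · exact mul_nonpos_of_nonneg_of_nonpos (hx q) (not_lt.1 hq)
      _ = t * ∑ q ∈ S, α q := by rw [← Finset.sum_filter, Finset.mul_sum]
      _ ≤ t * M := mul_le_mul_of_nonneg_left (hα S hS) ht

/-- Bound on `[0, 1]^Q` for a linear functional in terms of its sums over the subsets of `Q` with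
at least `|Q| - 1` elements. -/
theorem sum_mul_le_of_card_sub_one_le_sum {Q : Type*} [Fintype Q]
    {α x : Q → ℝ} {M N : ℝ} (hM : ∀ q, ∑ i, α i - α q ≤ M) (hN : ∑ i, α i ≤ N)
    (hx : ∀ q, x q ≤ 1) (hsum : (Fintype.card Q : ℝ) - 1 ≤ ∑ q, x q) :
    ∑ q, x q * α q ≤
      ((Fintype.card Q : ℝ) - ∑ q, x q) * M + (∑ q, x q - (Fintype.card Q : ℝ) + 1) * N := by
  have hle : ∑ q, (1 - x q) * (∑ i, α i - α q) ≤ ∑ q, (1 - x q) * M :=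
    Finset.sum_le_sum fun q _ => mul_le_mul_of_nonneg_left (hM q) (sub_nonneg.2 (hx q))
  simp only [mul_sub, sub_mul, Finset.sum_sub_distrib, ← Finset.sum_mul, Finset.sum_const,
    Finset.card_univ, nsmul_eq_mul, one_mul] at hle
  have h := mul_le_mul_of_nonneg_left hN
    (show 0 ≤ ∑ q, x q - (Fintype.card Q : ℝ) + 1 by linarith)
  linarith

theorem sum_ite_eq_zero_one {Q : Type*} [Fintype Q] [DecidableEq Q] (i : Q) :
    ∑ q, (if q = i then (0 : ℝ) else 1) = (Fintype.card Q : ℝ) - 1 := by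
  rw [Finset.sum_congr rfl fun q _ => show (if q = i then (0 : ℝ) else 1) =
    1 - if q = i then 1 else 0 by split_ifs <;> ring]
  simp

theorem sum_le_card_sub_one_of_eq_zero {Q : Type*} [Fintype Q] [DecidableEq Q] {x : Q → ℝ}
    (hx : ∀ q, x q ≤ 1) {q₀ : Q} (h : x q₀ = 0) : ∑ q, x q ≤ (Fintype.card Q : ℝ) - 1 := by
  rw [← sum_ite_eq_zero_one q₀]
  refine Finset.sum_le_sum fun q _ => ?_
  split_ifs with hq
  · rw [hq, h]
  · exact hx q

/-- Proposition 6(b), single facility, condition (6), `|Q| ≥ 3`: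
with `s = (Σ_q x̄_q)/(|Q|−1)`, one of the three inequalities `x_d ≤ y_1 − r`,
`(1/(|Q|−1)) Σ_q x_q ≤ y_1 − r`, `Σ_q x_q ≤ y_1 − r + |Q| − 2` solves the
separation problem according to the case, and each of the three is
facet-defining for `P`. -/
theorem single_facility_case2_large {Q T : Type*} [Fintype Q] [Fintype T]
    [DecidableEq Q] [DecidableEq T]
    (a : Q → ℝ) (b : T → ℝ) (c : ℝ) (t1 : T) (hT : ∀ t : T, t = t1)
    (ha : ∀ q, 0 < a q) (hb : ∀ t, 0 < b t) (hb1 : ∀ t, b t1 ≤ b t)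
    (hc : 0 < ∑ q, a q - c)
    (hQ : 3 ≤ Fintype.card Q)
    (r : ℝ) (hr : r = max ((⌈-c / b t1⌉ : ℤ) : ℝ) 0)
    (h1 : ∀ q, a q ≤ b t1) (h2 : ∀ q, b t1 * r + c < a q)
    (h3 : ∀ q' : Q, ∑ q, a q - a q' ≤ b t1 * (r + 1) + c ∧
      b t1 * (r + 1) + c < ∑ q, a q)
    (xb : Q → ℝ) (yb : T → ℝ) (hxy : (xb, yb) ∈ ufXLP a b c)
    (d : Q) (hd : ∀ q, xb q ≤ xb d)
    (s : ℝ) (hs : s = (∑ q, xb q) / ((Fintype.card Q : ℝ) - 1)) :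
    ((s ≤ xb d →
        ufOptSol1 a b c t1 xb yb (Pi.single d (1 : ℝ)) (Pi.single t1 (1 : ℝ)) (-r)) ∧
     (xb d < s → s ≤ 1 →
        ufOptSol1 a b c t1 xb yb (fun _ => 1 / ((Fintype.card Q : ℝ) - 1))
          (Pi.single t1 (1 : ℝ)) (-r)) ∧
     (1 < s →
        ufOptSol1 a b c t1 xb yb (fun _ => (1 : ℝ)) (Pi.single t1 (1 : ℝ))
          (-r + (Fintype.card Q : ℝ) - 2))) ∧
    ufFacet a b c (Pi.single d (1 : ℝ)) (Pi.single t1 (1 : ℝ)) (-r) ∧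
    ufFacet a b c (fun _ => 1 / ((Fintype.card Q : ℝ) - 1)) (Pi.single t1 (1 : ℝ)) (-r) ∧
    ufFacet a b c (fun _ => (1 : ℝ)) (Pi.single t1 (1 : ℝ))
      (-r + (Fintype.card Q : ℝ) - 2) := by
  have hsumT : ∀ g : T → ℝ, ∑ t, g t = g t1 := fun g =>
    Fintype.sum_eq_single t1 fun t ht => absurd (hT t) ht
  have hcardT : Fintype.card T = 1 := Fintype.card_eq_one_iff.2 ⟨t1, hT⟩
  have hbt := hb t1
  obtain ⟨k, hk⟩ : ∃ k : ℕ, r = k :=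
    ⟨⌈-c / b t1⌉.toNat, by rw [hr]; exact_mod_cast (Int.toNat_eq_max _).symm⟩
  have hr0 : 0 ≤ b t1 * r + c := by
    have h : -c / b t1 ≤ r := by rw [hr]; exact (Int.le_ceil _).trans (le_max_left _ _)
    rw [div_le_iff₀ hbt] at h
    linarith
  have hr_le : ∀ m : ℕ, 0 ≤ b t1 * m + c → k ≤ m := by
    intro m hm
    have h : -c / b t1 ≤ m := by rw [div_le_iff₀ hbt]; linarith
    have h' : (⌈-c / b t1⌉ : ℤ) ≤ m := Int.ceil_le.2 (by exact_mod_cast h)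
    have : r ≤ m := by
      rw [hr]
      exact max_le (by exact_mod_cast h') (Nat.cast_nonneg m)
    rw [hk] at this
    exact_mod_cast this
  have hn : (3 : ℝ) ≤ Fintype.card Q := by exact_mod_cast hQ
  have hn1 : (0 : ℝ) < (Fintype.card Q : ℝ) - 1 := by linarith
  have hle_one : ∀ p ∈ ufX a b c, ∀ q, 0 ≤ p.1 q ∧ p.1 q ≤ 1 := by
    intro p hp q
    rcases hp.1 q with h | h <;> rw [h] <;> norm_num
  -- the three levels of `X`
  have hX : ∀ p ∈ ufX a b c, (p.2 t1 = r ∧ ∀ q, p.1 q = 0) ∨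
      (p.2 t1 = r + 1 ∧ ∃ q, p.1 q = 0) ∨ r + 2 ≤ p.2 t1 := by
    intro p hp
    obtain ⟨m, hm⟩ := hp.2.1 t1
    have hcap := hp.2.2
    rw [hsumT, hm] at hcap
    have hterm : ∀ q, 0 ≤ a q * p.1 q := fun q => mul_nonneg (ha q).le (hle_one p hp q).1
    have hkm := hr_le m ((Finset.sum_nonneg fun q _ => hterm q).trans hcap)
    rw [hm, hk]
    obtain rfl | rfl | h : m = k ∨ m = k + 1 ∨ k + 2 ≤ m := by omega
    · refine Or.inl ⟨rfl, fun q => (hp.1 q).resolve_right fun hq => ?_⟩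
      have h := Finset.single_le_sum (fun q _ => hterm q) (Finset.mem_univ q)
      have := h2 q
      rw [hq, mul_one] at h
      rw [hk] at this
      linarith
    · refine Or.inr (Or.inl ⟨by push_cast; ring, ?_⟩)
      by_contra! hne
      have hone : ∀ q, p.1 q = 1 := fun q => (hp.1 q).resolve_left (hne q)
      have := (h3 d).2
      simp only [hone, mul_one] at hcap
      rw [hk] at this
      push_cast at hcap
      linarith
    · exact Or.inr (Or.inr (by exact_mod_cast h))
  have hmem_zero : ((fun _ => 0, fun _ => r) : (Q → ℝ) × (T → ℝ)) ∈ ufX a b c := by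
    refine ⟨fun _ => Or.inl rfl, fun _ => ⟨k, hk⟩, ?_⟩
    rw [hsumT]
    simpa using hr0
  have hmem_proper : ∀ x : Q → ℝ, (∀ q, x q = 0 ∨ x q = 1) → (∃ q, x q = 0) →
      ((x, fun _ => r + 1) : (Q → ℝ) × (T → ℝ)) ∈ ufX a b c := by
    rintro x hx ⟨q₀, hq₀⟩
    refine ⟨hx, fun _ => ⟨k + 1, by simp [hk]⟩, ?_⟩
    rw [hsumT]
    refine le_trans ?_ (h3 q₀).1
    simp only
    rw [← Finset.sum_erase_eq_sub (Finset.mem_univ q₀),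
      ← Finset.sum_erase_add _ _ (Finset.mem_univ q₀), hq₀, mul_zero, add_zero]
    refine Finset.sum_le_sum fun q _ => ?_
    rcases hx q with h | h <;> rw [h]
    · simpa using (ha q).le
    · simp
  have hmem_full : ((fun _ => 1, fun _ => r + 2) : (Q → ℝ) × (T → ℝ)) ∈ ufX a b c := by
    refine ⟨fun _ => Or.inr rfl, fun _ => ⟨k + 2, by simp [hk]⟩, ?_⟩
    rw [hsumT]
    have := (h3 d).1
    have := h1 d
    simp only [mul_one]
    linarith
  have hsum_le : ∀ p ∈ ufX a b c, ∑ q, p.1 q ≤ Fintype.card Q := fun p hp =>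
    (Finset.sum_le_sum fun q _ => (hle_one p hp q).2).trans_eq (by simp)
  -- validity
  have hv1 : ufValid a b c (Pi.single d (1 : ℝ)) (Pi.single t1 (1 : ℝ)) (-r) := by
    intro p hp
    rw [hsumT]
    simp only [Pi.single_apply, ite_mul, one_mul, zero_mul, Finset.sum_ite_eq', Finset.mem_univ,
      if_true]
    have h := (hle_one p hp d).2
    rcases hX p hp with ⟨hy, h0⟩ | ⟨hy, _⟩ | hy
    · rw [hy, h0 d]; linarith
    · linarith
    · linarith
  have hv2 : ufValid a b c (fun _ => 1 / ((Fintype.card Q : ℝ) - 1))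
      (Pi.single t1 (1 : ℝ)) (-r) := by
    intro p hp
    rw [hsumT, Pi.single_eq_same, ← Finset.mul_sum, one_mul, one_div, inv_mul_le_iff₀ hn1]
    rcases hX p hp with ⟨hy, h0⟩ | ⟨hy, q, hq⟩ | hy
    · simp [hy, h0]
    · have := sum_le_card_sub_one_of_eq_zero (fun q => (hle_one p hp q).2) hq
      rw [hy]
      linarith
    · have := hsum_le p hp
      nlinarith
  have hv3 : ufValid a b c (fun _ => (1 : ℝ)) (Pi.single t1 (1 : ℝ))
      (-r + (Fintype.card Q : ℝ) - 2) := by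
    intro p hp
    rw [hsumT, Pi.single_eq_same, ← Finset.mul_sum, one_mul, one_mul]
    rcases hX p hp with ⟨hy, h0⟩ | ⟨hy, q, hq⟩ | hy
    · simp only [hy, h0, Finset.sum_const_zero]; linarith
    · have := sum_le_card_sub_one_of_eq_zero (fun q => (hle_one p hp q).2) hq
      linarith
    · have := hsum_le p hp
      linarith
  -- constraints on the coefficients of valid inequalities
  have hconstr : ∀ (α : Q → ℝ) (β : T → ℝ) (γ : ℝ), β t1 = 1 → ufValid a b c α β γ →
      0 ≤ r + γ ∧ (∀ S : Finset Q, S ≠ Finset.univ → ∑ q ∈ S, α q ≤ r + 1 + γ) ∧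
      ∑ q, α q ≤ r + 2 + γ := by
    intro α β γ hβ hval
    refine ⟨?_, fun S hS => ?_, ?_⟩
    · have h := hval _ hmem_zero
      rw [hsumT, hβ] at h
      simpa using h
    · obtain ⟨q₀, hq₀⟩ : ∃ q, q ∉ S := by
        by_contra! h
        exact hS (Finset.eq_univ_iff_forall.2 h)
      have h := hval _ (hmem_proper (fun q => if q ∈ S then 1 else 0)
        (fun q => (ite_eq_or_eq (q ∈ S) (1 : ℝ) 0).symm) ⟨q₀, if_neg hq₀⟩)
      rw [hsumT, hβ] at h
      simpa using h
    · have h := hval _ hmem_full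
      rw [hsumT, hβ] at h
      simpa using h
  have hx := hxy.1
  have hne : Nonempty Q := ⟨d⟩
  have hopt : ∀ t : ℝ, xb d ≤ t → s ≤ t → t ≤ 1 → ∀ (α : Q → ℝ) (β : T → ℝ) (γ : ℝ),
      β t1 = 1 → ufValid a b c α β γ →
      ∑ q, xb q * α q - ∑ t, yb t * β t - γ ≤ t - yb t1 + r := by
    intro t hdt hst ht α β γ hβ hval
    obtain ⟨hg, hS, -⟩ := hconstr α β γ hβ hval
    rw [hs, div_le_iff₀ hn1, mul_comm] at hst
    have h := sum_mul_le_of_proper_subset_sum_le hS (fun q => (hx q).1)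
      (fun q => (hd q).trans hdt) hst
    have := mul_le_mul_of_nonneg_right ht hg
    rw [hsumT, hβ]
    linarith
  have hsum_eq : ∑ q, xb q = ((Fintype.card Q : ℝ) - 1) * s := by
    rw [hs, mul_div_cancel₀ _ hn1.ne']
  refine ⟨⟨fun h => ⟨Pi.single_eq_same _ _, hv1, fun α β γ hβ hval => ?_⟩,
    fun h h' => ⟨Pi.single_eq_same _ _, hv2, fun α β γ hβ hval => ?_⟩,
    fun h => ⟨Pi.single_eq_same _ _, hv3, fun α β γ hβ hval => ?_⟩⟩, ?_, ?_, ?_⟩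
  · refine (hopt (xb d) le_rfl h (hx d).2 α β γ hβ hval).trans_eq ?_
    rw [hsumT]
    simp [Pi.single_apply]
  · refine (hopt s h.le le_rfl h' α β γ hβ hval).trans_eq ?_
    rw [hsumT, ← Finset.sum_mul, hsum_eq, Pi.single_eq_same]
    field_simp
    ring
  · obtain ⟨-, hS, hN⟩ := hconstr α β γ hβ hval
    have hM : ∀ q, ∑ i, α i - α q ≤ r + 1 + γ := fun q => by
      rw [← Finset.sum_erase_eq_sub (Finset.mem_univ q)]
      exact hS _ (Finset.erase_ssubset (Finset.mem_univ q)).ne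
    have hle : (Fintype.card Q : ℝ) - 1 ≤ ∑ q, xb q := by
      rw [hsum_eq]
      exact le_mul_of_one_le_right hn1.le h.le
    have := sum_mul_le_of_card_sub_one_le_sum hM hN (fun q => (hx q).2) hle
    rw [hsumT, hsumT, hβ, Pi.single_eq_same, ← Finset.sum_mul]
    linarith
  · refine ufFacet_of_linearIndependent hcardT hv1 (fun _ => 0, fun _ => r)
      (fun i => (fun q => if q = d ∨ q = i then 1 else 0, fun _ => r + 1)) hmem_zero
      (fun i => hmem_proper _ (fun q => (ite_eq_or_eq _ (1 : ℝ) 0).symm) ?_)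
      ?_ (fun i => ?_) ?_
    · obtain ⟨q, hq⟩ : ∃ q, q ∉ ({d, i} : Finset Q) := by
        by_contra! h
        have hcard := Finset.card_le_two (a := d) (b := i)
        rw [Finset.eq_univ_iff_forall.2 h, Finset.card_univ] at hcard
        omega
      exact ⟨q, if_neg (by simpa using hq)⟩
    · rw [hsumT]
      simp
    · rw [hsumT, Fintype.sum_eq_single d fun q hq => by simp [hq]]
      simp
    · rw [Fintype.linearIndependent_iff]
      intro u hu
      have hsnd := congrFun (congrArg Prod.snd hu) t1
      simp only [Prod.snd_sum, Prod.smul_snd, Prod.snd_sub, Finset.sum_apply, Pi.smul_apply,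
        Pi.sub_apply, smul_eq_mul, Prod.snd_zero, Pi.zero_apply, add_sub_cancel_left,
        mul_one] at hsnd
      have hoff : ∀ q, q ≠ d → u q = 0 := by
        intro q hq
        have hfst := congrFun (congrArg Prod.fst hu) q
        simpa [Prod.fst_sum, Finset.sum_apply, hq] using hfst
      intro q
      by_cases hq : q = d
      · rw [hq, ← hsnd]
        exact (Fintype.sum_eq_single d hoff).symm
      · exact hoff q hq
  · refine ufFacet_of_linearIndependent hcardT hv2 (fun _ => 0, fun _ => r)
      (fun i => (fun q => if q = i then 0 else 1, fun _ => r + 1)) hmem_zero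
      (fun i => hmem_proper _ (fun q => ite_eq_or_eq _ (0 : ℝ) 1) ⟨i, if_pos rfl⟩)
      ?_ (fun i => ?_) ?_
    · rw [hsumT]
      simp
    · rw [hsumT, ← Finset.mul_sum, sum_ite_eq_zero_one, Pi.single_eq_same]
      field_simp
      ring
    · rw [Fintype.linearIndependent_iff]
      intro u hu q
      have hsnd := congrFun (congrArg Prod.snd hu) t1
      simp only [Prod.snd_sum, Prod.smul_snd, Prod.snd_sub, Finset.sum_apply, Pi.smul_apply,
        Pi.sub_apply, smul_eq_mul, Prod.snd_zero, Pi.zero_apply, add_sub_cancel_left,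
        mul_one] at hsnd
      have hfst := congrFun (congrArg Prod.fst hu) q
      simp only [Prod.fst_sum, Prod.smul_fst, Prod.fst_sub, Finset.sum_apply, Pi.smul_apply,
        Pi.sub_apply, smul_eq_mul, Prod.fst_zero, Pi.zero_apply, sub_zero] at hfst
      rw [Finset.sum_congr rfl fun i _ => show u i * (if q = i then (0 : ℝ) else 1) =
        u i - if q = i then u i else 0 by split_ifs <;> ring] at hfst
      simpa [hsnd] using hfst
  · refine ufFacet_of_linearIndependent hcardT hv3 (fun _ => 1, fun _ => r + 2)
      (fun i => (fun q => if q = i then 0 else 1, fun _ => r + 1)) hmem_full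
      (fun i => hmem_proper _ (fun q => ite_eq_or_eq _ (0 : ℝ) 1) ⟨i, if_pos rfl⟩)
      ?_ (fun i => ?_) ?_
    · rw [hsumT]
      simp
    · rw [hsumT, ← Finset.mul_sum, sum_ite_eq_zero_one, Pi.single_eq_same]
      ring
    · rw [Fintype.linearIndependent_iff]
      intro u hu q
      have hfst := congrFun (congrArg Prod.fst hu) q
      simp only [Prod.fst_sum, Prod.smul_fst, Prod.fst_sub, Finset.sum_apply, Pi.smul_apply,
        Pi.sub_apply, smul_eq_mul, Prod.fst_zero, Pi.zero_apply] at hfst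
      rw [Finset.sum_congr rfl fun i _ => show u i * ((if q = i then (0 : ℝ) else 1) - 1) =
        if q = i then -u i else 0 by split_ifs <;> ring] at hfst
      simpa using hfst
end

section
/- Suppose |T| ≥ 2 and Σ_{q∈Q} a_q ≤ b_t + c for all t ∈ T \ {1}. If (x̄, ȳ) ∈ X_LP satisfies Σ_{t∈T\{1}} ȳ_t ≥ 1, then (x̄, ȳ) ∈ P. -/
open scoped BigOperators

/-- Every real `r ≥ k` is a convex combination of natural numbers that are at least `k`. -/
theorem mem_convexHull_natCast_ge (k : ℕ) {r : ℝ} (hr : (k : ℝ) ≤ r) :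
    r ∈ convexHull ℝ {x : ℝ | ∃ n : ℕ, k ≤ n ∧ x = n} := by
  have h0 : 0 ≤ r := k.cast_nonneg.trans hr
  have hk : k ≤ ⌊r⌋₊ := Nat.le_floor hr
  refine segment_subset_convexHull (s := {x : ℝ | ∃ n : ℕ, k ≤ n ∧ x = n})
    (x := (⌊r⌋₊ : ℝ)) (y := ((⌊r⌋₊ + 1 : ℕ) : ℝ)) ⟨_, hk, rfl⟩ ⟨_, by omega, rfl⟩ ?_
  rw [segment_eq_Icc (by push_cast; linarith)]
  exact ⟨Nat.floor_le h0, by push_cast; exact (Nat.lt_floor_add_one r).le⟩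

/-- Every point of the unit cube is a convex combination of its vertices. -/
theorem mem_convexHull_zero_one_pi {Q : Type*} [Finite Q] {x : Q → ℝ}
    (hx : ∀ q, 0 ≤ x q ∧ x q ≤ 1) :
    x ∈ convexHull ℝ {v : Q → ℝ | ∀ q, v q = 0 ∨ v q = 1} := by
  have h : {v : Q → ℝ | ∀ q, v q = 0 ∨ v q = 1} = Set.univ.pi fun _ => ({0, 1} : Set ℝ) := by
    ext v
    simp
  rw [h, convexHull_pi]
  intro q _
  rw [convexHull_pair, segment_eq_Icc zero_le_one]
  exact hx q

/-- A nonnegative vector whose coordinate at `t` is at least `1` is a convex combination of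
natural vectors whose coordinate at `t` is at least `1`. -/
theorem mem_convexHull_natCast_pi {T : Type*} [Finite T] {y : T → ℝ} (t : T)
    (hy : ∀ u, 0 ≤ y u) (ht : 1 ≤ y t) :
    y ∈ convexHull ℝ {v : T → ℝ | (∀ u, ∃ n : ℕ, v u = n) ∧ 1 ≤ v t} := by
  classical
  have h : y ∈ convexHull ℝ (Set.univ.pi fun u =>
      {x : ℝ | ∃ n : ℕ, (if u = t then 1 else 0) ≤ n ∧ x = n}) := by
    rw [convexHull_pi]
    intro u _
    apply mem_convexHull_natCast_ge
    split_ifs with hu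
    · subst hu
      simpa using ht
    · simpa using hy u
  refine convexHull_mono ?_ h
  refine fun v hv => ⟨fun u => ?_, ?_⟩
  · obtain ⟨n, -, hn⟩ := hv u trivial
    exact ⟨n, hn⟩
  · obtain ⟨n, h1, hn⟩ := hv t trivial
    rw [if_pos rfl] at h1
    rw [hn]
    exact_mod_cast h1

/-- A nonnegative vector whose coordinates other than `t1` sum to at least `1` is a convex
combination of natural vectors having a coordinate other than `t1` that is at least `1`. -/
theorem mem_convexHull_natCast_exists_ge {T : Type*} [Fintype T] [DecidableEq T] {y : T → ℝ}
    (t1 : T) (hy : ∀ u, 0 ≤ y u) (hsum : 1 ≤ ∑ t ∈ Finset.univ.erase t1, y t) :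
    y ∈ convexHull ℝ {v : T → ℝ | (∀ u, ∃ n : ℕ, v u = n) ∧ ∃ t, t ≠ t1 ∧ 1 ≤ v t} := by
  set S := ∑ t ∈ Finset.univ.erase t1, y t with hS
  have hS0 : 0 < S := by linarith
  let z : T → T → ℝ := fun t u => if u = t1 then y t1 else if u = t then S else 0
  have hw : ∑ t ∈ Finset.univ.erase t1, y t / S = 1 := by
    rw [← Finset.sum_div, ← hS, div_self hS0.ne']
  have hz : ∑ t ∈ Finset.univ.erase t1, (y t / S) • z t = y := by
    funext u
    rw [Finset.sum_apply]
    simp only [Pi.smul_apply, smul_eq_mul, z]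
    by_cases hu : u = t1
    · simp only [hu, if_true]
      rw [← Finset.sum_mul, hw, one_mul]
    · simp [hu, hS0.ne']
  rw [← hz]
  refine (convex_convexHull ℝ _).sum_mem (fun t _ => div_nonneg (hy t) hS0.le) hw
    fun t ht => ?_
  have htt : t ≠ t1 := Finset.ne_of_mem_erase ht
  have hsub : {v : T → ℝ | (∀ u, ∃ n : ℕ, v u = n) ∧ 1 ≤ v t} ⊆
      {v | (∀ u, ∃ n : ℕ, v u = n) ∧ ∃ t, t ≠ t1 ∧ 1 ≤ v t} :=
    fun v hv => ⟨hv.1, t, htt, hv.2⟩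
  refine convexHull_mono hsub (mem_convexHull_natCast_pi t (fun u => ?_) ?_)
  · simp only [z]
    split_ifs
    exacts [hy t1, hS0.le, le_rfl]
  · simpa [z, htt] using hsum

/-- if `|T| ≥ 2` and `Σ_q a_q ≤ b_t + c` for all `t ≠ 1`, then any
`(x̄, ȳ) ∈ X_LP` with `Σ_{t≠1} ȳ_t ≥ 1` lies in `P`. -/
theorem multifacility_in_P {Q T : Type*} [Fintype Q] [Fintype T] [DecidableEq T]
    (a : Q → ℝ) (b : T → ℝ) (c : ℝ) (t1 : T)
    (ha : ∀ q, 0 < a q) (hb : ∀ t, 0 < b t) (hb1 : ∀ t, b t1 ≤ b t)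
    (hc : 0 < ∑ q, a q - c)
    (hT : 2 ≤ Fintype.card T)
    (hiii : ∀ t, t ≠ t1 → ∑ q, a q ≤ b t + c)
    (xb : Q → ℝ) (yb : T → ℝ) (hxy : (xb, yb) ∈ ufXLP a b c)
    (hy : 1 ≤ ∑ t ∈ Finset.univ.erase t1, yb t) :
    (xb, yb) ∈ ufP a b c := by
  have hmem : (xb, yb) ∈ convexHull ℝ ({v : Q → ℝ | ∀ q, v q = 0 ∨ v q = 1} ×ˢ
      {v : T → ℝ | (∀ u, ∃ n : ℕ, v u = n) ∧ ∃ t, t ≠ t1 ∧ 1 ≤ v t}) := by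
    rw [convexHull_prod]
    exact ⟨mem_convexHull_zero_one_pi hxy.1, mem_convexHull_natCast_exists_ge t1 hxy.2.1 hy⟩
  refine convexHull_mono ?_ hmem
  rintro ⟨x, y⟩ ⟨hx, hn, t, ht, h1⟩
  refine ⟨hx, hn, ?_⟩
  dsimp only at hx hn h1 ⊢
  have hx1 : ∑ q, a q * x q ≤ ∑ q, a q := by
    refine Finset.sum_le_sum fun q _ => mul_le_of_le_one_right (ha q).le ?_
    rcases hx q with h | h <;> norm_num [h]
  have hy0 : ∀ u, 0 ≤ y u := fun u => by
    obtain ⟨n, h⟩ := hn u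
    rw [h]
    exact n.cast_nonneg
  have hyt : b t * y t ≤ ∑ u, b u * y u :=
    Finset.single_le_sum (fun u _ => mul_nonneg (hb u).le (hy0 u)) (Finset.mem_univ t)
  have hbt : b t ≤ b t * y t := le_mul_of_one_le_right (hb t).le h1
  have := hiii t ht
  linarith
end

section
/- Suppose |T| ≥ 2, Q ≠ ∅, a_q ≤ b_1 and b_1·r + c < a_q for all q ∈ Q, Σ_{q∈Q} a_q ≤ b_t + c for all t ∈ T \ {1}, and Σ_{q∈Q} a_q ≤ b_1(r + 1) + c. Let (x̄, ȳ) ∈ X_LP with Σ_{t∈T\{1}} ȳ_t < 1, let Q̃ = {q ∈ Q : x̄_q > Σ_{t∈T\{1}} ȳ_t}, and let d ∈ Q maximize x̄_q over q ∈ Q. Then: (a) if Q̃ = ∅, the inequality 0 ≤ y_1 + r·Σ_{t∈T\{1}} y_t − r is an optimal solution of the separation problem for (x̄, ȳ); (b) if Q̃ ≠ ∅, the inequality x_d ≤ y_1 + (r + 1)·Σ_{t∈T\{1}} y_t − r is an optimal solution of the separation problem for (x̄, ȳ). In both cases the stated inequality is facet-defining for P. (Here an inequality α^⊤x ≤ β^⊤y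 + γ with β_1 = 1 and β_t ≥ 0 for all t ∈ T that is valid for X is an optimal solution of the separation problem for (x̄, ȳ) if it maximizes x̄^⊤α − ȳ^⊤β − γ among all such triples (α, β, γ).) -/
open scoped BigOperators

/-- `(α, β, γ)` (with `β_1 = 1`, `β ≥ 0`, valid for `X`) is an optimal solution of
the separation problem for `(x̄, ȳ)`: it maximizes `x̄᳐α − ȳ᳐β − γ` among all
such triples. -/
def ufOptSol {Q T : Type*} [Fintype Q] [Fintype T]
    (a : Q → ℝ) (b : T → ℝ) (c : ℝ) (t1 : T) (xb : Q → ℝ) (yb : T → ℝ)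
    (α : Q → ℝ) (β : T → ℝ) (γ : ℝ) : Prop :=
  β t1 = 1 ∧ (∀ t, 0 ≤ β t) ∧ ufValid a b c α β γ ∧
  ∀ (α' : Q → ℝ) (β' : T → ℝ) (γ' : ℝ), β' t1 = 1 → (∀ t, 0 ≤ β' t) →
    ufValid a b c α' β' γ' →
    ∑ q, xb q * α' q - ∑ t, yb t * β' t - γ' ≤
      ∑ q, xb q * α q - ∑ t, yb t * β t - γ

lemma ufFacet_of_points {Q T : Type*} [Fintype Q] [Fintype T]
    {a : Q → ℝ} {b : T → ℝ} {c : ℝ} {α : Q → ℝ} {β : T → ℝ} {γ : ℝ}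
    (hv : ufValid a b c α β γ)
    (pts : Q ⊕ T → (Q → ℝ) × (T → ℝ)) (hpts : ∀ i, pts i ∈ ufX a b c)
    (heq : ∀ i, ∑ q, α q * (pts i).1 q = ∑ t, β t * (pts i).2 t + γ)
    (hind : ∀ w : Q ⊕ T → ℝ, ∑ i, w i = 0 → (∀ q, ∑ i, w i * (pts i).1 q = 0) →
      (∀ t, ∑ i, w i * (pts i).2 t = 0) → ∀ i, w i = 0) :
    ufFacet a b c α β γ := by
  let e : Fin (Fintype.card Q + Fintype.card T) ≃ Q ⊕ T :=
    (Fintype.equivFinOfCardEq Fintype.card_sum).symm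
  refine ⟨hv, pts ∘ e, fun i => ⟨subset_convexHull ℝ _ (hpts _), heq _⟩, ?_⟩
  refine AffineIndependent.comp_embedding e.toEmbedding ?_
  rw [affineIndependent_iff_of_fintype]
  intro w hw h
  rw [Finset.weightedVSub_eq_linear_combination _ hw] at h
  refine hind w hw (fun q => ?_) fun t => ?_
  · simpa [Prod.fst_sum] using congrFun (congrArg Prod.fst h) q
  · simpa [Prod.snd_sum] using congrFun (congrArg Prod.snd h) t

section Aux

variable {Q T : Type*} [Fintype Q] [Fintype T] [DecidableEq T]
  {a : Q → ℝ} {b : T → ℝ} {c : ℝ} {t1 : T} {n : ℕ}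

lemma sum_ite_one_mul (t1 : T) (k : ℝ) (y : T → ℝ) :
    ∑ t, (if t = t1 then 1 else k) * y t = y t1 + k * ∑ t ∈ Finset.univ.erase t1, y t := by
  rw [← Finset.add_sum_erase _ _ (Finset.mem_univ t1), if_pos rfl, one_mul, Finset.mul_sum]
  congr 1
  exact Finset.sum_congr rfl fun t ht => by rw [if_neg (Finset.ne_of_mem_erase ht)]

lemma sum_mul_single (β : T → ℝ) (t : T) (v : ℝ) :
    ∑ u, β u * (Pi.single t v : T → ℝ) u = β t * v := by
  simp [Pi.single_apply]

lemma sum_mul_binary_le (ha : ∀ q, 0 < a q) {x : Q → ℝ} (hx : ∀ q, x q = 0 ∨ x q = 1) :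
    ∑ q, a q * x q ≤ ∑ q, a q :=
  Finset.sum_le_sum fun q _ => by rcases hx q with h | h <;> simp [h, (ha q).le]

lemma zero_single_mem_ufX {t : T} {m : ℕ} (h : 0 ≤ b t * m + c) :
    ((0 : Q → ℝ), (Pi.single t (m : ℝ) : T → ℝ)) ∈ ufX a b c := by
  refine ⟨fun q => Or.inl rfl, fun u => ?_, ?_⟩
  · rcases eq_or_ne u t with rfl | hu
    · exact ⟨m, by simp⟩
    · exact ⟨0, by simp [hu]⟩
  · simpa [sum_mul_single] using h

lemma single_mem_ufX (ha : ∀ q, 0 < a q) {x : Q → ℝ} (hx : ∀ q, x q = 0 ∨ x q = 1)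
    {t : T} {m : ℕ} (h : ∑ q, a q ≤ b t * m + c) :
    (x, (Pi.single t (m : ℝ) : T → ℝ)) ∈ ufX a b c := by
  refine ⟨hx, fun u => ?_, ?_⟩
  · rcases eq_or_ne u t with rfl | hu
    · exact ⟨m, by simp⟩
    · exact ⟨0, by simp [hu]⟩
  · have := sum_mul_binary_le ha hx
    simp only [sum_mul_single]
    linarith

/-- A point of `X` uses a facility other than `t1`, or exactly `n` units of `t1` and serves nothing,
or at least `n + 1` units of `t1`. -/
lemma ufX_cases (ha : ∀ q, 0 < a q) (hmin : ∀ m : ℕ, 0 ≤ b t1 * m + c → n ≤ m)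
    (h2 : ∀ q, b t1 * n + c < a q) {p : (Q → ℝ) × (T → ℝ)} (hp : p ∈ ufX a b c) :
    (0 ≤ p.2 t1 ∧ 1 ≤ ∑ t ∈ Finset.univ.erase t1, p.2 t) ∨
      ((∑ t ∈ Finset.univ.erase t1, p.2 t = 0) ∧
        (p.1 = 0 ∧ p.2 t1 = n ∨ (n : ℝ) + 1 ≤ p.2 t1)) := by
  obtain ⟨hx, hy, hs⟩ := hp
  have hx0 : ∀ q, 0 ≤ a q * p.1 q := fun q => by
    rcases hx q with h | h <;> simp [h, (ha q).le]
  have hy0 : ∀ t, 0 ≤ p.2 t := fun t => by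
    obtain ⟨m, hm⟩ := hy t
    rw [hm]
    positivity
  by_cases hz : ∃ t, t ≠ t1 ∧ p.2 t ≠ 0
  · obtain ⟨t, ht, hne⟩ := hz
    refine Or.inl ⟨hy0 t1, ?_⟩
    have h1 : 1 ≤ p.2 t := by
      obtain ⟨m, hm⟩ := hy t
      rw [hm] at hne ⊢
      exact_mod_cast Nat.one_le_iff_ne_zero.2 (by exact_mod_cast hne)
    exact h1.trans (Finset.single_le_sum (fun u _ => hy0 u) (by simp [ht]))
  · push Not at hz
    refine Or.inr ⟨Finset.sum_eq_zero fun t ht => hz t (Finset.ne_of_mem_erase ht), ?_⟩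
    obtain ⟨m, hm⟩ := hy t1
    rw [Finset.sum_eq_single t1 (fun t _ ht => by simp [hz t ht]) (by simp), hm] at hs
    have hnm : n ≤ m := hmin m ((Finset.sum_nonneg fun q _ => hx0 q).trans hs)
    rcases hnm.eq_or_lt with rfl | hlt
    · refine Or.inl ⟨funext fun q => (hx q).resolve_right fun h => ?_, hm⟩
      have h3 := Finset.single_le_sum (fun q _ => hx0 q) (Finset.mem_univ q)
      rw [h, mul_one] at h3
      linarith [h2 q]
    · right
      rw [hm]
      exact_mod_cast hlt

lemma ufValid_zero (ha : ∀ q, 0 < a q) (hmin : ∀ m : ℕ, 0 ≤ b t1 * m + c → n ≤ m)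
    (h2 : ∀ q, b t1 * n + c < a q) :
    ufValid a b c (0 : Q → ℝ) (fun t => if t = t1 then 1 else (n : ℝ)) (-n) := by
  intro p hp
  have hn : (0 : ℝ) ≤ n := n.cast_nonneg
  simp only [Pi.zero_apply, zero_mul, Finset.sum_const_zero, sum_ite_one_mul]
  rcases ufX_cases ha hmin h2 hp with ⟨h0, hz⟩ | ⟨hz, ⟨-, h⟩ | h⟩
  · nlinarith
  · rw [hz, h]
    simp
  · rw [hz]
    linarith

lemma ufValid_single [DecidableEq Q] (ha : ∀ q, 0 < a q)
    (hmin : ∀ m : ℕ, 0 ≤ b t1 * m + c → n ≤ m)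
    (h2 : ∀ q, b t1 * n + c < a q) (d : Q) :
    ufValid a b c (Pi.single d (1 : ℝ)) (fun t => if t = t1 then 1 else (n : ℝ) + 1) (-n) := by
  intro p hp
  have hn : (0 : ℝ) ≤ n := n.cast_nonneg
  have hd : p.1 d ≤ 1 := by rcases hp.1 d with h | h <;> simp [h]
  have hsum : ∑ q, (Pi.single d (1 : ℝ) : Q → ℝ) q * p.1 q = p.1 d := by
    simp [Pi.single_apply]
  rw [sum_ite_one_mul, hsum]
  rcases ufX_cases ha hmin h2 hp with ⟨h0, hz⟩ | ⟨hz, ⟨hx, h⟩ | h⟩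
  · nlinarith
  · rw [hz, h, hx]
    simp
  · rw [hz]
    linarith

/-- Bounds on the coefficients of a valid inequality, with `A` the sum of the positive parts of the
coefficients of `x`. -/
lemma ufValid.coeff_bounds (ha : ∀ q, 0 < a q) (hn : 0 ≤ b t1 * n + c)
    (hiii : ∀ t, t ≠ t1 → ∑ q, a q ≤ b t + c) (h3 : ∑ q, a q ≤ b t1 * (n + 1) + c)
    {α : Q → ℝ} {β : T → ℝ} {γ : ℝ} (hβ : β t1 = 1) (hv : ufValid a b c α β γ) :
    0 ≤ n + γ ∧ ∑ q, max (α q) 0 ≤ n + 1 + γ ∧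
      ∀ t, t ≠ t1 → ∑ q, max (α q) 0 ≤ β t + γ := by
  let x : Q → ℝ := fun q => if 0 < α q then 1 else 0
  have hx : ∀ q, x q = 0 ∨ x q = 1 := fun q => by
    by_cases h : 0 < α q <;> simp [x, h]
  have hA : ∑ q, α q * x q = ∑ q, max (α q) 0 := Finset.sum_congr rfl fun q _ => by
    by_cases h : 0 < α q
    · simp [x, h, h.le]
    · simp [x, h, not_lt.1 h]
  refine ⟨?_, ?_, fun t ht => ?_⟩
  · simpa [sum_mul_single, hβ] using hv _ (zero_single_mem_ufX hn)
  · have := hv _ (single_mem_ufX (t := t1) (m := n + 1) ha hx (by exact_mod_cast h3))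
    simpa [sum_mul_single, hβ, hA] using this
  · have := hv _ (single_mem_ufX (t := t) (m := 1) ha hx (by simpa using hiii t ht))
    simpa [sum_mul_single, hA] using this

/-- An upper bound on the violation of a valid inequality, in terms of two scalars `A` and `γ`. -/
lemma ufValid.exists_violation_le (ha : ∀ q, 0 < a q) (hn : 0 ≤ b t1 * n + c)
    (hiii : ∀ t, t ≠ t1 → ∑ q, a q ≤ b t + c) (h3 : ∑ q, a q ≤ b t1 * (n + 1) + c)
    {α : Q → ℝ} {β : T → ℝ} {γ : ℝ} (hβ : β t1 = 1) (hv : ufValid a b c α β γ)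
    {x : Q → ℝ} {y : T → ℝ} (hx : ∀ q, 0 ≤ x q) (hy : ∀ t, 0 ≤ y t)
    {d : Q} (hd : ∀ q, x q ≤ x d) :
    ∃ A : ℝ, 0 ≤ A ∧ 0 ≤ n + γ ∧ A ≤ n + 1 + γ ∧
      ∑ q, x q * α q - ∑ t, y t * β t - γ ≤
        x d * A - (y t1 + (∑ t ∈ Finset.univ.erase t1, y t) * (A - γ)) - γ := by
  obtain ⟨h1, h2, ht⟩ := hv.coeff_bounds ha hn hiii h3 hβ
  refine ⟨∑ q, max (α q) 0, Finset.sum_nonneg fun q _ => le_max_right _ _, h1, h2, ?_⟩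
  have hX : ∑ q, x q * α q ≤ x d * ∑ q, max (α q) 0 := by
    rw [Finset.mul_sum]
    exact Finset.sum_le_sum fun q _ =>
      (mul_le_mul_of_nonneg_left (le_max_left _ 0) (hx q)).trans
        (mul_le_mul_of_nonneg_right (hd q) (le_max_right _ _))
  have hY : y t1 + (∑ t ∈ Finset.univ.erase t1, y t) * (∑ q, max (α q) 0 - γ) ≤
      ∑ t, y t * β t := by
    rw [← Finset.add_sum_erase _ (fun t => y t * β t) (Finset.mem_univ t1), hβ, mul_one,
      Finset.sum_mul]
    gcongr with t h
    · exact hy t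
    · linarith [ht t (Finset.ne_of_mem_erase h)]
  linarith

lemma ufFacet_zero [DecidableEq Q] (ha : ∀ q, 0 < a q) (hn : 0 ≤ b t1 * n + c)
    (hmin : ∀ m : ℕ, 0 ≤ b t1 * m + c → n ≤ m) (h2 : ∀ q, b t1 * n + c < a q)
    (hiii : ∀ t, t ≠ t1 → ∑ q, a q ≤ b t + c) (hT : 2 ≤ Fintype.card T) :
    ufFacet a b c (0 : Q → ℝ) (fun t => if t = t1 then 1 else (n : ℝ)) (-n) := by
  obtain ⟨t0, ht0⟩ := Fintype.exists_ne_of_one_lt_card (by omega) t1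
  let pts : Q ⊕ T → (Q → ℝ) × (T → ℝ) := Sum.elim
    (fun q => (Pi.single q 1, Pi.single t0 ((1 : ℕ) : ℝ)))
    (fun t => (0, if t = t1 then Pi.single t1 (n : ℝ) else Pi.single t ((1 : ℕ) : ℝ)))
  refine ufFacet_of_points (ufValid_zero ha hmin h2) pts ?_ ?_ ?_
  · rintro (q | t)
    · exact single_mem_ufX ha (fun u => by rcases eq_or_ne u q with rfl | h <;> simp [*])
        (by simpa using hiii t0 ht0)
    · by_cases ht : t = t1
      · simpa [pts, ht] using zero_single_mem_ufX hn
      · simpa [pts, ht] using single_mem_ufX (m := 1) (x := 0) ha (fun _ => Or.inl rfl)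
          (by simpa using hiii t ht)
  · rintro (q | t)
    · simp [pts, sum_mul_single, ht0, -ite_mul]
    · by_cases ht : t = t1 <;> simp [pts, sum_mul_single, ht, -ite_mul]
  · intro w hw hq ht
    simp only [Fintype.sum_sum_type, pts, Sum.elim_inl, Sum.elim_inr] at hw hq ht
    have hQ : ∀ q, w (Sum.inl q) = 0 := fun q => by
      simpa [Pi.single_apply] using hq q
    have hT' : ∀ t, t ≠ t1 → w (Sum.inr t) = 0 := fun t h => by
      have := ht t
      rw [Finset.sum_eq_single (s := Finset.univ (α := T)) t] at this
      · simpa [hQ, h] using this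
      · intro u _ hu
        by_cases h' : u = t1 <;> simp [h', h, hu.symm]
      · simp
    have h1 : w (Sum.inr t1) = 0 := by
      rw [Finset.sum_eq_single (s := Finset.univ (α := T)) t1] at hw
      · simpa [hQ] using hw
      · intro u _ hu
        exact hT' u hu
      · simp
    rintro (q | t)
    · exact hQ q
    · by_cases h : t = t1
      · rw [h, h1]
      · exact hT' t h

lemma ufFacet_single [DecidableEq Q] (ha : ∀ q, 0 < a q) (hn : 0 ≤ b t1 * n + c)
    (hmin : ∀ m : ℕ, 0 ≤ b t1 * m + c → n ≤ m) (h2 : ∀ q, b t1 * n + c < a q)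
    (hiii : ∀ t, t ≠ t1 → ∑ q, a q ≤ b t + c) (h3 : ∑ q, a q ≤ b t1 * (n + 1) + c) (d : Q) :
    ufFacet a b c (Pi.single d (1 : ℝ)) (fun t => if t = t1 then 1 else (n : ℝ) + 1) (-n) := by
  let pts : Q ⊕ T → (Q → ℝ) × (T → ℝ) := Sum.elim
    (fun q => if q = d then (0, Pi.single t1 (n : ℝ))
      else (Pi.single d 1 + Pi.single q 1, Pi.single t1 ((n + 1 : ℕ) : ℝ)))
    (fun t => (Pi.single d 1,
      if t = t1 then Pi.single t1 ((n + 1 : ℕ) : ℝ) else Pi.single t ((1 : ℕ) : ℝ)))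
  have h3' : ∑ q, a q ≤ b t1 * ((n + 1 : ℕ) : ℝ) + c := by exact_mod_cast h3
  have hbin : ∀ q, (Pi.single d 1 : Q → ℝ) q = 0 ∨ (Pi.single d 1 : Q → ℝ) q = 1 := fun q => by
    rcases eq_or_ne q d with rfl | h <;> simp [*]
  refine ufFacet_of_points (ufValid_single ha hmin h2 d) pts ?_ ?_ ?_
  · rintro (q | t)
    · by_cases hq : q = d
      · simpa [pts, hq] using zero_single_mem_ufX hn
      · simp only [pts, Sum.elim_inl, if_neg hq]
        refine single_mem_ufX ha (fun u => ?_) h3'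
        by_cases hu : u = d
        · subst hu
          simp [Ne.symm hq]
        · by_cases hu' : u = q <;> simp [hu, hu', hq]
    · by_cases ht : t = t1
      · simp only [pts, Sum.elim_inr, if_pos ht]
        exact single_mem_ufX ha hbin h3'
      · simp only [pts, Sum.elim_inr, if_neg ht]
        exact single_mem_ufX ha hbin (by simpa using hiii t ht)
  · rintro (q | t)
    · by_cases hq : q = d
      · simp [pts, sum_mul_single, hq, -ite_mul]
      · simp [pts, sum_mul_single, hq, mul_add, Finset.sum_add_distrib, -ite_mul]
    · by_cases ht : t = t1 <;> simp [pts, sum_mul_single, ht, -ite_mul]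
  · intro w hw hq ht
    simp only [Fintype.sum_sum_type, pts, Sum.elim_inl, Sum.elim_inr] at hw hq ht
    have hQ : ∀ q, q ≠ d → w (Sum.inl q) = 0 := fun q h => by
      have := hq q
      rw [Finset.sum_eq_single (s := Finset.univ (α := Q)) q] at this
      · simpa [h] using this
      · intro u _ hu
        by_cases h' : u = d <;> simp [h', h, hu.symm]
      · simp
    have hT' : ∀ t, t ≠ t1 → w (Sum.inr t) = 0 := fun t h => by
      have := ht t
      rw [Finset.sum_eq_zero (s := Finset.univ (α := Q)),
        Finset.sum_eq_single (s := Finset.univ (α := T)) t] at this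
      · simpa [h] using this
      · intro u _ hu
        by_cases h' : u = t1 <;> simp [h', h, hu.symm]
      · simp
      · intro u _
        by_cases h' : u = d <;> simp [h', h]
    have h1 : w (Sum.inr t1) = 0 := by
      have := hq d
      rw [Finset.sum_eq_zero (s := Finset.univ (α := Q)),
        Finset.sum_eq_single (s := Finset.univ (α := T)) t1] at this
      · simpa using this
      · intro u _ hu
        simp [hT' u hu]
      · simp
      · intro u _
        by_cases h' : u = d
        · simp [h']
        · simp [hQ u h']
    have hR : ∀ t, w (Sum.inr t) = 0 := fun t => by
      by_cases h : t = t1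
      · rw [h, h1]
      · exact hT' t h
    have hD : w (Sum.inl d) = 0 := by
      rw [Finset.sum_eq_single (s := Finset.univ (α := Q)) d] at hw
      · simpa [hR] using hw
      · intro u _ hu
        exact hQ u hu
      · simp
    rintro (q | t)
    · by_cases h : q = d
      · rw [h, hD]
      · exact hQ q h
    · exact hR t

end Aux

/-- Proposition 7, multifacility, condition (5): with
`Q̃ = {q : x̄_q > Σ_{t≠1} ȳ_t}`, if `Q̃ = ∅` then `0 ≤ y_1 + r Σ_{t≠1} y_t − r`
solves the separation problem, and if `Q̃ ≠ ∅` then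
`x_d ≤ y_1 + (r+1) Σ_{t≠1} y_t − r` solves it; in both cases the inequality is
facet-defining for `P`. -/
theorem multifacility_case1 {Q T : Type*} [Fintype Q] [Fintype T] [Nonempty Q]
    [DecidableEq Q] [DecidableEq T]
    (a : Q → ℝ) (b : T → ℝ) (c : ℝ) (t1 : T)
    (ha : ∀ q, 0 < a q) (hb : ∀ t, 0 < b t) (hb1 : ∀ t, b t1 ≤ b t)
    (hc : 0 < ∑ q, a q - c)
    (hT : 2 ≤ Fintype.card T)
    (r : ℝ) (hr : r = max ((⌈-c / b t1⌉ : ℤ) : ℝ) 0)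
    (h1 : ∀ q, a q ≤ b t1) (h2 : ∀ q, b t1 * r + c < a q)
    (hiii : ∀ t, t ≠ t1 → ∑ q, a q ≤ b t + c)
    (h3 : ∑ q, a q ≤ b t1 * (r + 1) + c)
    (xb : Q → ℝ) (yb : T → ℝ) (hxy : (xb, yb) ∈ ufXLP a b c)
    (hy : ∑ t ∈ Finset.univ.erase t1, yb t < 1)
    (d : Q) (hd : ∀ q, xb q ≤ xb d) :
    ({q : Q | (∑ t ∈ Finset.univ.erase t1, yb t) < xb q} = ∅ →
      ufOptSol a b c t1 xb yb (0 : Q → ℝ)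
        (fun t => if t = t1 then 1 else r) (-r) ∧
      ufFacet a b c (0 : Q → ℝ) (fun t => if t = t1 then 1 else r) (-r)) ∧
    ({q : Q | (∑ t ∈ Finset.univ.erase t1, yb t) < xb q} ≠ ∅ →
      ufOptSol a b c t1 xb yb (Pi.single d (1 : ℝ))
        (fun t => if t = t1 then 1 else r + 1) (-r) ∧
      ufFacet a b c (Pi.single d (1 : ℝ))
        (fun t => if t = t1 then 1 else r + 1) (-r)) := by
  obtain ⟨n, rfl, hn, hmin⟩ : ∃ n : ℕ, r = n ∧ 0 ≤ b t1 * n + c ∧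
      ∀ m : ℕ, 0 ≤ b t1 * m + c → n ≤ m := by
    refine ⟨⌈-c / b t1⌉₊, ?_, ?_, fun m hm => ?_⟩
    · rw [hr, ← Int.ceil_toNat, ← Int.cast_natCast, Int.toNat_eq_max]
      simp
    · have := (div_le_iff₀ (hb t1)).1 (Nat.le_ceil (-c / b t1))
      linarith
    · rw [Nat.ceil_le, div_le_iff₀ (hb t1)]
      linarith
  obtain ⟨hx, hy0, -⟩ := hxy
  have hn0 : (0 : ℝ) ≤ n := n.cast_nonneg
  have hs0 : 0 ≤ ∑ t ∈ Finset.univ.erase t1, yb t := Finset.sum_nonneg fun t _ => hy0 t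
  have hsum : ∀ k : ℝ, ∑ t, yb t * (if t = t1 then 1 else k) =
      yb t1 + k * ∑ t ∈ Finset.univ.erase t1, yb t := fun k => by
    simp_rw [mul_comm (yb _)]
    exact sum_ite_one_mul t1 k yb
  refine ⟨fun hQ => ⟨⟨by simp, fun t => ?_, ufValid_zero ha hmin h2, ?_⟩,
    ufFacet_zero ha hn hmin h2 hiii hT⟩, fun hQ => ⟨⟨by simp, fun t => ?_,
    ufValid_single ha hmin h2 d, ?_⟩, ufFacet_single ha hn hmin h2 hiii h3 d⟩⟩
  · dsimp only
    split_ifs <;> positivity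
  · intro α β γ hβ _ hv
    have hds : xb d ≤ ∑ t ∈ Finset.univ.erase t1, yb t :=
      not_lt.1 fun h => (Set.eq_empty_iff_forall_notMem.1 hQ d) h
    obtain ⟨A, hA, h4, h5, h6⟩ := hv.exists_violation_le ha hn hiii h3 hβ
      (fun q => (hx q).1) hy0 hd
    refine h6.trans ?_
    simp only [hsum, Pi.zero_apply, mul_zero, Finset.sum_const_zero]
    nlinarith [mul_nonneg (sub_nonneg.2 hds) hA, mul_nonneg (sub_nonneg.2 hy.le) h4]
  · dsimp only
    split_ifs <;> positivity
  · intro α β γ hβ _ hv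
    have hds : ∑ t ∈ Finset.univ.erase t1, yb t < xb d := by
      obtain ⟨q, hq⟩ := Set.nonempty_iff_ne_empty.2 hQ
      exact lt_of_lt_of_le hq (hd q)
    have hd1 : xb d ≤ 1 := (hx d).2
    obtain ⟨A, hA, h4, h5, h6⟩ := hv.exists_violation_le ha hn hiii h3 hβ
      (fun q => (hx q).1) hy0 hd
    refine h6.trans ?_
    simp only [hsum, sum_mul_single, mul_one]
    rcases le_total A 1 with h | h
    · nlinarith [mul_nonneg (sub_nonneg.2 hds.le) (sub_nonneg.2 h),
        mul_nonneg (sub_nonneg.2 hy.le) h4]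
    · nlinarith [mul_nonneg (sub_nonneg.2 hd1) (sub_nonneg.2 h),
        mul_nonneg (sub_nonneg.2 hy.le) (sub_nonneg.2 h5)]
end

section
/- Suppose |T| ≥ 2, 1 ≤ |Q| ≤ 2, a_q ≤ b_1 and b_1·r + c < a_q for all q ∈ Q, Σ_{q∈Q} a_q ≤ b_t + c for all t ∈ T \ {1}, and Σ_{q∈Q} a_q − a_{q'} ≤ b_1(r + 1) + c < Σ_{q∈Q} a_q for every q' ∈ Q. Let (x̄, ȳ) ∈ X_LP with Σ_{t∈T\{1}} ȳ_t < 1 and suppose Q̃ = {q ∈ Q : x̄_q > Σ_{t∈T\{1}} ȳ_t} equals Q. Then the inequality Σ_{q∈Q} x_q ≤ y_1 + (r + |Q|)·Σ_{t∈T\{1}} y_t − r is an optimal solution of the separation problem for (x̄, ȳ), and it is facet-defining for P. (Here an inequality α^⊤x ≤ β^⊤y + γ with β_1 = 1 and β_t ≥ 0 for all t ∈ T that is valid for X is an optimal solution of the separation problem for (x̄, ȳ) if it maximizes x̄^⊤α − ȳ^⊤β − γ among all such triples (α, β, γ).) -/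
open scoped BigOperators

/-- The point `(0, n e₁)` (at `Sum.inr t1`), the points `(e_q, (n + 1) e₁)` and the points
`(𝟏, e_t)` for `t ≠ t1`. -/
noncomputable def tightPoint {Q T : Type*} [DecidableEq Q] [DecidableEq T] (t1 : T) (n : ℕ) :
    Q ⊕ T → (Q → ℝ) × (T → ℝ)
  | Sum.inl q => (Pi.single q 1, Pi.single t1 ((n : ℝ) + 1))
  | Sum.inr t => if t = t1 then (0, Pi.single t1 (n : ℝ)) else (fun _ => 1, Pi.single t 1)

theorem affineIndependent_tightPoint {Q T : Type*} [Fintype Q] [Fintype T]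
    [DecidableEq Q] [DecidableEq T] (t1 : T) (n : ℕ) :
    AffineIndependent ℝ (tightPoint (Q := Q) t1 n) := by
  rw [affineIndependent_iff_of_fintype]
  intro w hw hs
  rw [Finset.univ.weightedVSub_eq_linear_combination hw, Fintype.sum_sum_type] at hs
  rw [Fintype.sum_sum_type] at hw
  have hT : ∀ t, t ≠ t1 → w (Sum.inr t) = 0 := by
    intro t ht
    have h := congrFun (congrArg Prod.snd hs) t
    simp only [Prod.snd_add, Prod.snd_sum, Prod.smul_snd, Pi.add_apply, Finset.sum_apply,
      Pi.smul_apply, smul_eq_mul, Prod.snd_zero, Pi.zero_apply] at h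
    rw [Finset.sum_eq_zero, Finset.sum_eq_single t] at h
    · simpa [tightPoint, ht] using h
    · intro s _ hst
      by_cases hs1 : s = t1
      · simp [tightPoint, hs1, ht]
      · simp [tightPoint, hs1, Ne.symm hst]
    · simp
    · intro q _
      simp [tightPoint, ht]
  have hQ : ∀ q, w (Sum.inl q) = 0 := by
    intro q
    have h := congrFun (congrArg Prod.fst hs) q
    simp only [Prod.fst_add, Prod.fst_sum, Prod.smul_fst, Pi.add_apply, Finset.sum_apply,
      Pi.smul_apply, smul_eq_mul, Prod.fst_zero, Pi.zero_apply] at h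
    rw [Finset.sum_eq_single q, Finset.sum_eq_zero (s := (Finset.univ : Finset T))] at h
    · simpa [tightPoint] using h
    · intro t _
      by_cases ht : t = t1
      · simp [tightPoint, ht]
      · simp [hT t ht]
    · intro q' _ hq
      simp [tightPoint, Ne.symm hq]
    · simp
  have h1 : w (Sum.inr t1) = 0 := by
    rw [Finset.sum_eq_zero fun q _ => hQ q, Finset.sum_eq_single t1
      (fun t _ ht => hT t ht) (by simp)] at hw
    simpa using hw
  rintro (q | t)
  · exact hQ q
  · by_cases ht : t = t1
    · rw [ht, h1]
    · exact hT t ht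

theorem tightPoint_mem_ufX {Q T : Type*} [Fintype Q] [Fintype T]
    [DecidableEq Q] [DecidableEq T] {a : Q → ℝ} {b : T → ℝ} {c : ℝ} {t1 : T} {n : ℕ}
    (hn : 0 ≤ b t1 * n + c) (h1 : ∀ q, a q ≤ b t1)
    (hiii : ∀ t, t ≠ t1 → ∑ q, a q ≤ b t + c) (i : Q ⊕ T) :
    tightPoint t1 n i ∈ ufX a b c := by
  rcases i with q | t
  · refine ⟨fun q' => ?_, fun t => ?_, ?_⟩
    · by_cases h : q' = q <;> simp [tightPoint, h]
    · by_cases h : t = t1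
      · exact ⟨n + 1, by simp [tightPoint, h]⟩
      · exact ⟨0, by simp [tightPoint, h]⟩
    · simp only [tightPoint, Pi.single_apply, mul_ite, mul_one, mul_zero, Finset.sum_ite_eq',
        Finset.mem_univ, if_true]
      linarith [h1 q]
  · by_cases ht : t = t1
    · refine ⟨fun q' => by simp [tightPoint, ht], fun t' => ?_, ?_⟩
      · by_cases h : t' = t1
        · exact ⟨n, by simp [tightPoint, h, ht]⟩
        · exact ⟨0, by simp [tightPoint, h, ht]⟩
      · simpa [tightPoint, ht, Pi.single_apply] using hn
    · refine ⟨fun q' => by simp [tightPoint, ht], fun t' => ?_, ?_⟩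
      · by_cases h : t' = t
        · exact ⟨1, by simp [tightPoint, h, ht]⟩
        · exact ⟨0, by simp [tightPoint, h, ht]⟩
      · simpa [tightPoint, ht, Pi.single_apply] using hiii t ht

theorem tightPoint_tight {Q T : Type*} [Fintype Q] [Fintype T]
    [DecidableEq Q] [DecidableEq T] (t1 : T) (n : ℕ) (i : Q ⊕ T) :
    ∑ q, (1 : ℝ) * (tightPoint t1 n i).1 q =
      ∑ t, (if t = t1 then 1 else (n : ℝ) + Fintype.card Q) * (tightPoint t1 n i).2 t + -n := by
  rcases i with q | t
  · simp [tightPoint, Pi.single_apply]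
  · by_cases ht : t = t1 <;> simp [tightPoint, ht, Pi.single_apply]

theorem sum_eq_add_sum_erase {T : Type*} [Fintype T] [DecidableEq T] (f : T → ℝ) (t1 : T) :
    ∑ t, f t = f t1 + ∑ t ∈ Finset.univ.erase t1, f t :=
  (Finset.add_sum_erase _ _ (Finset.mem_univ t1)).symm

theorem sum_ite_mul_eq {T : Type*} [Fintype T] [DecidableEq T] (y : T → ℝ) (t1 : T) (k : ℝ) :
    ∑ t, (if t = t1 then 1 else k) * y t = y t1 + k * ∑ t ∈ Finset.univ.erase t1, y t := by
  rw [sum_eq_add_sum_erase _ t1, Finset.mul_sum, if_pos rfl, one_mul]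
  congr 1
  refine Finset.sum_congr rfl fun t ht => ?_
  rw [if_neg (Finset.ne_of_mem_erase ht)]

theorem ufValid_of_card_two {Q T : Type*} [Fintype Q] [Fintype T]
    [DecidableEq Q] [DecidableEq T] {a : Q → ℝ} {b : T → ℝ} {c : ℝ} {t1 : T} {n : ℕ}
    {q₁ q₂ : Q} (hne : q₁ ≠ q₂) (hU : (Finset.univ : Finset Q) = {q₁, q₂})
    (ha : ∀ q, 0 < a q) (hmin : ∀ k : ℕ, 0 ≤ b t1 * k + c → n ≤ k)
    (h2 : ∀ q, b t1 * n + c < a q) (h3 : b t1 * (n + 1) + c < ∑ q, a q) :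
    ufValid a b c (fun _ => (1 : ℝ))
      (fun t => if t = t1 then 1 else (n : ℝ) + 2) (-(n : ℝ)) := by
  rintro ⟨x, y⟩ ⟨hx, hy, hxy⟩
  dsimp only at hx hy hxy ⊢
  rw [sum_ite_mul_eq]
  rw [hU, Finset.sum_pair hne] at h3 hxy ⊢
  have hn0 : (0 : ℝ) ≤ n := n.cast_nonneg
  have hy0 : ∀ t, 0 ≤ y t := fun t => by
    obtain ⟨m, hm⟩ := hy t
    rw [hm]; exact m.cast_nonneg
  have hx1 : ∀ q, x q ≤ 1 := fun q => by rcases hx q with h | h <;> rw [h]; norm_num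
  by_cases hex : ∃ t, t ≠ t1 ∧ y t ≠ 0
  · obtain ⟨t, ht, hyt⟩ := hex
    have hle : y t ≤ ∑ t ∈ Finset.univ.erase t1, y t :=
      Finset.single_le_sum (fun i _ => hy0 i) (Finset.mem_erase.2 ⟨ht, Finset.mem_univ t⟩)
    have hone : 1 ≤ y t := by
      obtain ⟨m, hm⟩ := hy t
      rw [hm] at hyt ⊢
      exact_mod_cast Nat.one_le_iff_ne_zero.2 (by exact_mod_cast hyt)
    nlinarith [hx1 q₁, hx1 q₂, hy0 t1]
  · push Not at hex
    obtain ⟨k, hk⟩ := hy t1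
    rw [sum_eq_add_sum_erase _ t1, Finset.sum_eq_zero (s := Finset.univ.erase t1)
      (fun t ht => by rw [hex t (Finset.ne_of_mem_erase ht), mul_zero]), hk] at hxy
    rw [Finset.sum_eq_zero (fun t ht => hex t (Finset.ne_of_mem_erase ht)), hk]
    have hx0 : ∀ q, 0 ≤ x q := fun q => by rcases hx q with h | h <;> rw [h]; norm_num
    have hnk : n ≤ k := hmin k (by
      nlinarith [mul_nonneg (ha q₁).le (hx0 q₁), mul_nonneg (ha q₂).le (hx0 q₂)])
    obtain ⟨j, rfl⟩ := Nat.exists_eq_add_of_le hnk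
    have p1 := ha q₁
    have p2 := ha q₂
    have s1 := h2 q₁
    have s2 := h2 q₂
    rcases j with _ | _ | j
    · rcases hx q₁ with e1 | e1 <;> rcases hx q₂ with e2 | e2 <;> rw [e1, e2] at hxy ⊢ <;>
        push_cast at hxy ⊢ <;> linarith
    · rcases hx q₁ with e1 | e1 <;> rcases hx q₂ with e2 | e2 <;> rw [e1, e2] at hxy ⊢ <;>
        push_cast at hxy ⊢ <;> linarith
    · have : (0 : ℝ) ≤ j := j.cast_nonneg
      push_cast
      linarith [hx1 q₁, hx1 q₂]

theorem separation_bound_of_card_two {Q T : Type*} [Fintype Q] [Fintype T]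
    [DecidableEq Q] [DecidableEq T] {a : Q → ℝ} {b : T → ℝ} {c : ℝ} {t1 : T} {n : ℕ}
    {q₁ q₂ : Q} (hne : q₁ ≠ q₂) (hU : (Finset.univ : Finset Q) = {q₁, q₂})
    (hn : 0 ≤ b t1 * n + c) (h1 : ∀ q, a q ≤ b t1)
    (hiii : ∀ t, t ≠ t1 → ∑ q, a q ≤ b t + c)
    {xb : Q → ℝ} {yb : T → ℝ} (hx1 : ∀ q, xb q ≤ 1) (hy0 : ∀ t, 0 ≤ yb t)
    (hs : ∀ q, ∑ t ∈ Finset.univ.erase t1, yb t ≤ xb q)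
    {α : Q → ℝ} {β : T → ℝ} {γ : ℝ} (hβ : β t1 = 1) (hv : ufValid a b c α β γ) :
    ∑ q, xb q * α q - ∑ t, yb t * β t - γ ≤
      ∑ q, xb q - (yb t1 + (n + 2) * ∑ t ∈ Finset.univ.erase t1, yb t) + n := by
  have hA := hv _ (tightPoint_mem_ufX hn h1 hiii (Sum.inr t1))
  have hB := fun q => hv _ (tightPoint_mem_ufX hn h1 hiii (Sum.inl q))
  have hC : ∀ t, t ≠ t1 → α q₁ + α q₂ ≤ β t + γ := fun t ht => by
    simpa [tightPoint, ht, Pi.single_apply, hU, Finset.sum_pair hne] using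
      hv _ (tightPoint_mem_ufX hn h1 hiii (Sum.inr t))
  have hD : α q₁ + α q₂ ≤ n + 2 + γ := by
    have hmem : ((fun _ => 1, Pi.single t1 ((n : ℝ) + 2)) : (Q → ℝ) × (T → ℝ)) ∈ ufX a b c := by
      refine ⟨fun q => Or.inr rfl, fun t => ?_, ?_⟩
      · by_cases h : t = t1
        · exact ⟨n + 2, by simp [h]⟩
        · exact ⟨0, by simp [h]⟩
      · simp only [Pi.single_apply, mul_ite, mul_one, mul_zero, Finset.sum_ite_eq',
          Finset.mem_univ, if_true, hU, Finset.sum_pair hne]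
        linarith [h1 q₁, h1 q₂]
    simpa [Pi.single_apply, hβ, hU, Finset.sum_pair hne] using hv _ hmem
  simp only [tightPoint, if_true, Pi.single_apply, Pi.zero_apply, mul_ite, mul_one, mul_zero,
    Finset.sum_ite_eq', Finset.mem_univ, Finset.sum_const_zero, hβ, one_mul] at hA hB
  have hE : (∑ t ∈ Finset.univ.erase t1, yb t) * (α q₁ + α q₂ - γ) ≤
      ∑ t ∈ Finset.univ.erase t1, yb t * β t := by
    rw [Finset.sum_mul]
    exact Finset.sum_le_sum fun t ht => mul_le_mul_of_nonneg_left
      (by linarith [hC t (Finset.ne_of_mem_erase ht)]) (hy0 t)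
  rw [sum_eq_add_sum_erase (fun t => yb t * β t) t1, hβ, hU, Finset.sum_pair hne,
    Finset.sum_pair hne]
  generalize ∑ t ∈ Finset.univ.erase t1, yb t * β t = E at hE ⊢
  generalize ∑ t ∈ Finset.univ.erase t1, yb t = s at hE hs ⊢
  have u1 := hs q₁
  have u2 := hs q₂
  have v1 := hx1 q₁
  have v2 := hx1 q₂
  have B1 := hB q₁
  have B2 := hB q₂
  rcases le_total (xb q₁ - s + (xb q₂ - s)) (1 - s) with h | h
  · linarith [mul_le_mul_of_nonneg_left hA (sub_nonneg.2 h),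
      mul_le_mul_of_nonneg_left B1 (sub_nonneg.2 u1),
      mul_le_mul_of_nonneg_left B2 (sub_nonneg.2 u2)]
  · linarith [mul_le_mul_of_nonneg_left hD (sub_nonneg.2 h),
      mul_le_mul_of_nonneg_left B1 (sub_nonneg.2 v2),
      mul_le_mul_of_nonneg_left B2 (sub_nonneg.2 v1)]

theorem exists_nat_eq_max_ceil {β c : ℝ} (hβ : 0 < β) :
    ∃ n : ℕ, max ((⌈-c / β⌉ : ℤ) : ℝ) 0 = n ∧ 0 ≤ β * n + c ∧
      ∀ k : ℕ, 0 ≤ β * k + c → n ≤ k := by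
  refine ⟨⌈-c / β⌉₊, ?_, ?_, fun k hk => ?_⟩
  · rw [← Int.ceil_toNat, ← Int.cast_natCast, Int.toNat_eq_max]
    push_cast
    rfl
  · have := (div_le_iff₀ hβ).1 (Nat.le_ceil (-c / β))
    linarith
  · rw [Nat.ceil_le, div_le_iff₀ hβ]
    linarith

/-- Proposition 8(c), multifacility, condition (6), `|Q| ≤ 2`,
`Q̃ = Q`: the inequality `Σ_q x_q ≤ y_1 + (r+|Q|) Σ_{t≠1} y_t − r` solves the
separation problem for `(x̄, ȳ)` and is facet-defining for `P`. -/
theorem multifacility_case2_small {Q T : Type*} [Fintype Q] [Fintype T]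
    [DecidableEq Q] [DecidableEq T]
    (a : Q → ℝ) (b : T → ℝ) (c : ℝ) (t1 : T)
    (ha : ∀ q, 0 < a q) (hb : ∀ t, 0 < b t) (hb1 : ∀ t, b t1 ≤ b t)
    (hc : 0 < ∑ q, a q - c)
    (hT : 2 ≤ Fintype.card T)
    (hQ1 : 1 ≤ Fintype.card Q) (hQ2 : Fintype.card Q ≤ 2)
    (r : ℝ) (hr : r = max ((⌈-c / b t1⌉ : ℤ) : ℝ) 0)
    (h1 : ∀ q, a q ≤ b t1) (h2 : ∀ q, b t1 * r + c < a q)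
    (hiii : ∀ t, t ≠ t1 → ∑ q, a q ≤ b t + c)
    (h3 : ∀ q' : Q, ∑ q, a q - a q' ≤ b t1 * (r + 1) + c ∧
      b t1 * (r + 1) + c < ∑ q, a q)
    (xb : Q → ℝ) (yb : T → ℝ) (hxy : (xb, yb) ∈ ufXLP a b c)
    (hy : ∑ t ∈ Finset.univ.erase t1, yb t < 1)
    (hQtil : {q : Q | (∑ t ∈ Finset.univ.erase t1, yb t) < xb q} = Set.univ) :
    ufOptSol a b c t1 xb yb (fun _ => (1 : ℝ))
      (fun t => if t = t1 then 1 else r + (Fintype.card Q : ℝ)) (-r) ∧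
    ufFacet a b c (fun _ => (1 : ℝ))
      (fun t => if t = t1 then 1 else r + (Fintype.card Q : ℝ)) (-r) := by
  obtain ⟨n, hn, hn0, hmin⟩ := exists_nat_eq_max_ceil (c := c) (hb t1)
  rw [hn] at hr
  subst hr
  have hcard : Fintype.card Q = 2 := by
    refine le_antisymm hQ2 (Nat.succ_le_of_lt (lt_of_le_of_ne hQ1 fun h => ?_))
    obtain ⟨q, hq⟩ := Fintype.card_eq_one_iff.1 h.symm
    have h3q := (h3 q).2
    rw [Finset.sum_eq_single q (fun q' _ h' => (h' (hq q')).elim) (by simp)] at h3q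
    linarith [h1 q]
  obtain ⟨q₁, q₂, hne, hU⟩ := Finset.card_eq_two.1 (Finset.card_univ.trans hcard)
  have hk : (n : ℝ) + (Fintype.card Q : ℝ) = n + 2 := by rw [hcard]; norm_num
  have hvalid := ufValid_of_card_two hne hU ha hmin h2 (h3 q₁).2
  obtain ⟨hx, hy0, -⟩ := hxy
  refine ⟨⟨if_pos rfl, fun t => ?_, by simpa only [hk] using hvalid, ?_⟩,
    by simpa only [hk] using hvalid, ?_⟩
  · dsimp only
    split_ifs <;> positivity
  · intro α β γ hβ _ hv
    have hs : ∀ q, ∑ t ∈ Finset.univ.erase t1, yb t ≤ xb q := fun q =>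
      (Set.eq_univ_iff_forall.1 hQtil q).le
    refine (separation_bound_of_card_two hne hU hn0 h1 hiii (fun q => (hx q).2) hy0 hs
      hβ hv).trans_eq ?_
    simp only [mul_comm (yb _), sum_ite_mul_eq, hk, mul_one, sub_neg_eq_add]
  · let e : Fin (Fintype.card Q + Fintype.card T) ≃ Q ⊕ T :=
      (Fintype.equivFinOfCardEq Fintype.card_sum).symm
    exact ⟨fun i => tightPoint t1 n (e i),
      fun i => ⟨subset_convexHull ℝ _ (tightPoint_mem_ufX hn0 h1 hiii (e i)),
        tightPoint_tight t1 n (e i)⟩,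
      (affineIndependent_tightPoint t1 n).comp_embedding e.toEmbedding⟩
end

section
/- Let Q be a nonempty finite index set, let r ≥ 0 be a real number, let x̄ ∈ [0,1]^Q and ȳ_1 ≥ 0, and let d ∈ Q maximize x̄_q over q ∈ Q. Then the point (α, γ) = (e^d, −r) is feasible for the linear program max{Σ_{q∈Q} x̄_q α_q − ȳ_1 − γ : −r − γ ≤ 0, Σ_{q∈Q} α_q − (r+1) − γ ≤ 0, 0 ≤ α_q ≤ 1 for all q ∈ Q} and is an optimal solution: for every feasible (α, γ), Σ_{q∈Q} x̄_q α_q − ȳ_1 − γ ≤ x̄_d − ȳ_1 + r. -/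
open scoped BigOperators

/-- Lemma 3: the point `(e^d, −r)` is feasible and optimal for
the linear program
`max { Σ_q x̄_q α_q − ȳ_1 − γ : −r − γ ≤ 0, Σ_q α_q − (r+1) − γ ≤ 0,
0 ≤ α_q ≤ 1 }`. -/
theorem lp_single_constraint_opt {Q : Type*} [Fintype Q] [Nonempty Q] [DecidableEq Q]
    (r : ℝ) (hr : 0 ≤ r)
    (xb : Q → ℝ) (hx : ∀ q, 0 ≤ xb q ∧ xb q ≤ 1)
    (yb1 : ℝ) (hy : 0 ≤ yb1)
    (d : Q) (hd : ∀ q, xb q ≤ xb d) :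
    (-r - (-r) ≤ 0 ∧ (∑ q, (Pi.single d (1 : ℝ) : Q → ℝ) q) - (r + 1) - (-r) ≤ 0 ∧
      ∀ q, 0 ≤ (Pi.single d (1 : ℝ) : Q → ℝ) q ∧
        (Pi.single d (1 : ℝ) : Q → ℝ) q ≤ 1) ∧
    ∀ (α : Q → ℝ) (γ : ℝ), -r - γ ≤ 0 → (∑ q, α q) - (r + 1) - γ ≤ 0 →
      (∀ q, 0 ≤ α q ∧ α q ≤ 1) →
      ∑ q, xb q * α q - yb1 - γ ≤ xb d - yb1 + r := by
  refine ⟨⟨by simp, by simp, fun q => ?_⟩, fun α γ hγ hα hbox => ?_⟩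
  · by_cases h : q = d
    · subst h
      simp
    · simp [h]
  · have hsum : ∑ q, xb q * α q ≤ xb d * ∑ q, α q := by
      rw [Finset.mul_sum]
      exact Finset.sum_le_sum fun q _ => mul_le_mul_of_nonneg_right (hd q) (hbox q).1
    have hbound : xb d * ∑ q, α q ≤ xb d * (1 + (r + γ)) :=
      mul_le_mul_of_nonneg_left (by linarith) (hx d).1
    have hslack : xb d * (r + γ) ≤ r + γ :=
      mul_le_of_le_one_left (by linarith) (hx d).2
    linarith
end
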